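/- arXiv:1612.07652 — 3 statements merged into one kernel-verified Lean document; each statement's English description precedes it below -/
import Mathlib

section
/- Let P, Q be loopless matroids on the same ground set V with |V| = n, let D = P ∩ Q, let ζ = max(ζ(P), ζ(Q)), and let δ = 1/ζ − 1/n. Then for every partition of V into two sets A and B there exists a set S ∈ D with |S ∩ A| ≥ ⌊δ|A|⌋ − 1 and |S ∩ B| ≥ ⌊δ|B|⌋ − 1. -/
open Finset

variable {V : Type*} [Fintype V] [DecidableEq V]

/-- A matroid, given by its collection of independent sets (as a predicate on finsets). -/
def IsMatroid (Indep : Finset V → Prop) : Prop :=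
  Indep ∅ ∧ (∀ ⦃I J : Finset V⦄, Indep J → I ⊆ J → Indep I) ∧
    ∀ ⦃I J : Finset V⦄, Indep I → Indep J → I.card < J.card →
      ∃ x ∈ J, x ∉ I ∧ Indep (insert x I)

/-- Looplessness: every singleton is independent. -/
def Loopless (Indep : Finset V → Prop) : Prop := ∀ v : V, Indep {v}

open scoped Classical in
/-- The rank of a set `S`: maximal size of an independent subset of `S`. -/
noncomputable def rnk (Indep : Finset V → Prop) (S : Finset V) : ℕ :=
  (S.powerset.filter (fun e => Indep e)).sup Finset.card

/-- `ζ(M) = max over nonempty S of |S| / rank(S)`. -/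
noncomputable def zeta (Indep : Finset V → Prop) : ℝ :=
  sSup {x : ℝ | ∃ S : Finset V, S.Nonempty ∧ x = (S.card : ℝ) / (rnk Indep S : ℝ)}

/-- The edge covering number: minimal number of edges of the complex covering `V`. -/
noncomputable def beta (Indep : Finset V → Prop) : ℕ :=
  sInf {k : ℕ | ∃ F : Finset (Finset V), (∀ e ∈ F, Indep e) ∧
    (∀ v : V, ∃ e ∈ F, v ∈ e) ∧ F.card = k}

/-- The fractional edge covering number. -/
noncomputable def betaStar (D : Finset V → Prop) : ℝ :=
  sInf {x : ℝ | ∃ f : Finset V → ℝ, (∀ e, 0 ≤ f e) ∧ (∀ e, f e ≠ 0 → D e) ∧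
    (∀ v : V, 1 ≤ ∑ e : Finset V, if v ∈ e then f e else 0) ∧ x = ∑ e : Finset V, f e}

/-! ### Alternating paths -/

structure IsPath {Γ : Type*} (F : Finset V) (lab : Bool → V → Γ) (s : Bool) (L : ℕ)
    (e : ℕ → V) (v : ℕ → Γ) : Prop where
  mem : ∀ i < L, e i ∈ F
  left : ∀ i < L, lab (xor s (Nat.bodd i)) (e i) = v i
  right : ∀ i < L, lab (xor s (Nat.bodd (i+1))) (e i) = v (i+1)
  ne : ∀ i j, i < j → j ≤ L → Nat.bodd i = Nat.bodd j → v i ≠ v j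

theorem IsPath.inj {Γ : Type*} {F : Finset V} {lab : Bool → V → Γ} {s : Bool} {L : ℕ}
    {e : ℕ → V} {v : ℕ → Γ} (h : IsPath F lab s L e v) (i j : ℕ) (hij : i < j) (hj : j < L) :
    e i ≠ e j := by
  intro heq
  by_cases hp : Nat.bodd i = Nat.bodd j
  · apply h.ne i j hij hj.le hp
    rw [← h.left i (by omega), ← h.left j hj, heq, hp]
  · have hp' : Nat.bodd i = Nat.bodd (j+1) := by
      rw [Nat.bodd_succ]; revert hp; cases Nat.bodd i <;> cases Nat.bodd j <;> simp
    apply h.ne i (j+1) (by omega) (by omega) hp'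
    rw [← h.left i (by omega), ← h.right j hj, heq, hp']

theorem IsPath.length_le {Γ : Type*} {F : Finset V} {lab : Bool → V → Γ} {s : Bool} {L : ℕ}
    {e : ℕ → V} {v : ℕ → Γ} (h : IsPath F lab s L e v) : L ≤ Fintype.card V := by
  have := Finset.card_le_univ ((range L).image e)
  rw [Finset.card_image_of_injOn, Finset.card_range] at this
  · exact this
  · intro i hi j hj hij
    simp only [coe_range, Set.mem_Iio] at hi hj
    rcases lt_trichotomy i j with h1 | h1 | h1
    · exact absurd hij (h.inj i j h1 hj)
    · exact h1
    · exact absurd hij.symm (h.inj j i h1 hi)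

theorem path_exists {Γ : Type*} (F : Finset V) (hF : F.Nonempty) (lab : Bool → V → Γ) (z : Γ)
    (hdeg : ∀ s, ∀ e ∈ F, lab s e ≠ z → ∃ e' ∈ F, e' ≠ e ∧ lab s e' = lab s e) :
    ∃ (s : Bool) (k : ℕ) (e : ℕ → V) (v : ℕ → Γ), IsPath F lab s (2*k+1) e v ∧
      ((v 0 = z ∧ v (2*k+1) = z) ∨ ∃ c ∈ F, (∀ i < 2*k+1, c ≠ e i) ∧ lab s c = v 0 ∧
        lab (!s) c = v (2*k+1)) := by
  classical
  let Pr : ℕ → Prop := fun L => ∃ (s : Bool) (e : ℕ → V) (v : ℕ → Γ), IsPath F lab s L e v ∧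
    ((∃ s, ∃ a ∈ F, lab s a = z) → v 0 = z)
  have hbase : Pr 1 := by
    have key : ∀ s, ∀ a ∈ F, ((∃ s, ∃ a ∈ F, lab s a = z) → lab s a = z) → Pr 1 := by
      intro s a ha hz
      refine ⟨s, fun _ => a, fun i => if i = 0 then lab s a else lab (!s) a, ?_, by simpa using hz⟩
      constructor
      · intro i _; exact ha
      · intro i hi; obtain rfl : i = 0 := by omega
        simp
      · intro i hi; obtain rfl : i = 0 := by omega
        simp
      · intro i j hij hj hp
        obtain rfl : i = 0 := by omega
        obtain rfl : j = 1 := by omega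
        simp at hp
    by_cases hl : ∃ s, ∃ a ∈ F, lab s a = z
    · obtain ⟨s, a, ha, h⟩ := hl
      exact key s a ha (fun _ => h)
    · obtain ⟨a, ha⟩ := hF
      exact key true a ha (fun h => absurd h hl)
  have hbd : ∀ L, Pr L → L ≤ Fintype.card V := fun L ⟨s, e, v, h, _⟩ => h.length_le
  set L := Nat.findGreatest Pr (Fintype.card V) with hL
  have hPL : Pr L := Nat.findGreatest_spec (hbd 1 hbase) hbase
  have hL1 : 1 ≤ L := Nat.le_findGreatest (hbd 1 hbase) hbase
  have hmax : ¬ Pr (L+1) := fun h => by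
    have := Nat.le_findGreatest (hbd _ h) h
    omega
  obtain ⟨s, e, v, hp, hst⟩ := hPL
  have hlast : lab (xor s (Nat.bodd L)) (e (L-1)) = v L := by
    have := hp.right (L-1) (by omega)
    rwa [Nat.sub_add_cancel hL1] at this
  have hlm := hp.mem (L-1) (by omega)
  by_cases hz : v L = z
  · have h0 : v 0 = z := hst ⟨_, _, hlm, hlast.trans hz⟩
    have hodd : Nat.bodd L = true := by
      by_contra hc
      refine hp.ne 0 L (by omega) le_rfl ?_ (h0.trans hz.symm)
      simpa using hc
    obtain ⟨k, hk⟩ : ∃ k, L = 2*k+1 := by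
      have := Nat.bodd_add_div2 L
      rw [hodd] at this
      exact ⟨L.div2, by simp at this; omega⟩
    rw [hk] at hp hz
    exact ⟨s, k, e, v, hp, Or.inl ⟨h0, hz⟩⟩
  · obtain ⟨c, hcF, hcne, hclab⟩ := hdeg _ _ hlm (hlast ▸ hz)
    rw [hlast] at hclab
    by_cases hext : ∀ i ≤ L, Nat.bodd i = Nat.bodd (L+1) → v i ≠ lab (xor s (Nat.bodd (L+1))) c
    · exfalso
      apply hmax
      refine ⟨s, fun i => if i < L then e i else c,
        fun i => if i ≤ L then v i else lab (xor s (Nat.bodd (L+1))) c, ?_, by simpa using hst⟩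
      constructor
      · intro i hi
        split_ifs with h
        · exact hp.mem i h
        · exact hcF
      · intro i hi
        rw [if_pos (show i ≤ L by omega)]
        split_ifs with h
        · exact hp.left i h
        · obtain rfl : i = L := by omega
          exact hclab
      · intro i hi
        by_cases h : i < L
        · rw [if_pos h, if_pos (show i+1 ≤ L by omega)]
          exact hp.right i h
        · obtain rfl : i = L := by omega
          simp
      · intro i j hij hj hpar
        rw [if_pos (show i ≤ L by omega)]
        split_ifs with h
        · exact hp.ne i j hij h hpar
        · obtain rfl : j = L+1 := by omega
          exact hext i (by omega) hpar
    · push Not at hext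
      obtain ⟨i, hiL, hpar, hvi⟩ := hext
      have hiL' : i < L := by
        rcases hiL.lt_or_eq with h | h
        · exact h
        · subst h; simp at hpar
      have hodd : Nat.bodd (L - i) = true := by
        have h1 : Nat.bodd (i + (L-i)) = Nat.bodd L := by congr 1; omega
        rw [Nat.bodd_add, hpar, Nat.bodd_succ] at h1
        revert h1; cases Nat.bodd L <;> cases Nat.bodd (L-i) <;> simp
      obtain ⟨k, hk⟩ : ∃ k, L - i = 2*k+1 := by
        have := Nat.bodd_add_div2 (L-i)
        rw [hodd] at this
        exact ⟨(L-i).div2, by simp at this; omega⟩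
      have hLk : L = i + (2*k+1) := by omega
      refine ⟨xor s (Nat.bodd i), k, fun m => e (i+m), fun m => v (i+m), ?_, Or.inr ⟨c, hcF, ?_, ?_, ?_⟩⟩
      · constructor
        · intro m hm; exact hp.mem _ (by omega)
        · intro m hm
          have := hp.left (i+m) (by omega)
          rwa [Nat.bodd_add, ← Bool.xor_assoc] at this
        · intro m hm
          have := hp.right (i+m) (by omega)
          rwa [add_assoc, Nat.bodd_add, ← Bool.xor_assoc] at this
        · intro a b hab hb hpar'
          refine hp.ne _ _ (by omega) (by omega) ?_
          rw [Nat.bodd_add, Nat.bodd_add, hpar']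
      · intro m hm hce
        dsimp only at hce
        by_cases hpm : Nat.bodd (i+m) = Nat.bodd L
        · refine hp.ne (i+m) L (by omega) le_rfl hpm ?_
          rw [← hp.left _ (by omega), ← hclab, hce, hpm]
        · have hpm' : Nat.bodd (i+m+1) = Nat.bodd L := by
            rw [Nat.bodd_succ]; revert hpm; cases Nat.bodd (i+m) <;> cases Nat.bodd L <;> simp
          by_cases hl : i+m+1 = L
          · apply hcne; rw [hce]; congr 1; omega
          · refine hp.ne (i+m+1) L (by omega) le_rfl hpm' ?_
            rw [← hp.right _ (by omega), ← hclab, hce, hpm']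
      · rw [hpar, ← hvi]; rfl
      · have : (!(xor s (Nat.bodd i))) = xor s (Nat.bodd L) := by
          rw [hpar, Nat.bodd_succ]; cases s <;> cases Nat.bodd L <;> rfl
        rw [this, hclab, hLk]
/-! ### Matroid rank -/

theorem card_le_rnk {M : Finset V → Prop} {I S : Finset V} (hI : M I) (h : I ⊆ S) :
    I.card ≤ rnk M S := by
  classical
  unfold rnk
  exact Finset.le_sup (f := Finset.card) (by simp [hI, h])

theorem exists_rnk {M : Finset V → Prop} (hM : IsMatroid M) (S : Finset V) :
    ∃ I, M I ∧ I ⊆ S ∧ I.card = rnk M S := by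
  classical
  have hne : (S.powerset.filter (fun e => M e)).Nonempty := ⟨∅, by simp [hM.1]⟩
  obtain ⟨I, hI, h⟩ := Finset.exists_mem_eq_sup _ hne Finset.card
  simp only [mem_filter, mem_powerset] at hI
  refine ⟨I, hI.2, hI.1, ?_⟩
  unfold rnk
  rw [← h]
  

theorem rnk_le_card {M : Finset V → Prop} (hM : IsMatroid M) (S : Finset V) :
    rnk M S ≤ S.card := by
  obtain ⟨I, _, hI, h⟩ := exists_rnk hM S
  rw [← h]; exact card_le_card hI

theorem exists_base {M : Finset V → Prop} (hM : IsMatroid M) {I S : Finset V} (hI : M I)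
    (hIS : I ⊆ S) : ∃ J, M J ∧ I ⊆ J ∧ J ⊆ S ∧ J.card = rnk M S := by
  induction h : rnk M S - I.card generalizing I with
  | zero =>
    have := card_le_rnk hI hIS
    exact ⟨I, hI, Subset.rfl, hIS, by omega⟩
  | succ n ih =>
    obtain ⟨K, hK, hKS, hKc⟩ := exists_rnk hM S
    obtain ⟨x, hxK, hxI, hx⟩ := hM.2.2 hI hK (by omega)
    obtain ⟨J, h1, h2, h3, h4⟩ := ih hx (insert_subset (hKS hxK) hIS)
      (by rw [card_insert_of_notMem hxI]; omega)
    exact ⟨J, h1, (subset_insert _ _).trans h2, h3, h4⟩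

theorem rnk_submod {M : Finset V → Prop} (hM : IsMatroid M) (S T : Finset V) :
    rnk M (S ∪ T) + rnk M (S ∩ T) ≤ rnk M S + rnk M T := by
  obtain ⟨I, hI, hIS, hIc⟩ := exists_rnk hM (S ∩ T)
  obtain ⟨J, hJ, hIJ, hJS, hJc⟩ := exists_base hM hI
    (hIS.trans (inter_subset_left.trans (subset_union_left (s₂ := T))))
  have h1 := card_le_rnk (hM.2.1 hJ (inter_subset_left (s₂ := S))) inter_subset_right
  have h2 := card_le_rnk (hM.2.1 hJ (inter_subset_left (s₂ := T))) inter_subset_right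
  have h3 := card_union_add_card_inter (J ∩ S) (J ∩ T)
  rw [← inter_union_distrib_left, ← inter_inter_distrib_left, inter_eq_left.2 hJS] at h3
  have h4 := card_le_card (subset_inter hIJ hIS)
  omega

/-! ### Polytope -/

structure InPoly (M : Bool → Finset V → Prop) (x : V → ℝ) : Prop where
  nonneg : ∀ e, 0 ≤ x e
  le : ∀ b S, ∑ e ∈ S, x e ≤ rnk (M b) S

def Tight (M : Finset V → Prop) (x : V → ℝ) (S : Finset V) : Prop :=
  ∑ e ∈ S, x e = rnk M S

theorem tight_union_inter {M : Finset V → Prop} (hM : IsMatroid M) {x : V → ℝ}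
    (hx : ∀ S, ∑ e ∈ S, x e ≤ rnk M S) {S T : Finset V} (hS : Tight M x S) (hT : Tight M x T) :
    Tight M x (S ∪ T) ∧ Tight M x (S ∩ T) := by
  unfold Tight at *
  have h1 := Finset.sum_union_inter (s₁ := S) (s₂ := T) (f := x)
  have h2 : ((rnk M (S ∪ T) + rnk M (S ∩ T) : ℕ) : ℝ) ≤ ((rnk M S + rnk M T : ℕ) : ℝ) :=
    Nat.cast_le.2 (rnk_submod hM S T)
  push_cast at h2
  have h3 := hx (S ∪ T)
  have h4 := hx (S ∩ T)
  constructor <;> linarith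

theorem tight_empty {M : Finset V → Prop} (hM : IsMatroid M) (x : V → ℝ) : Tight M x ∅ := by
  have := rnk_le_card hM ∅
  simp at this
  simp [Tight, this]

open scoped Classical in
noncomputable def lbl (M : Finset V → Prop) (x : V → ℝ) (e : V) : Finset (Finset V) :=
  univ.filter (fun S => Tight M x S ∧ e ∈ S)

theorem mem_lbl {M : Finset V → Prop} {x : V → ℝ} {e : V} {S : Finset V} :
    S ∈ lbl M x e ↔ Tight M x S ∧ e ∈ S := by simp [lbl]

/-- The largest tight set avoiding `e`. -/
theorem exists_max_tight {M : Finset V → Prop} (hM : IsMatroid M) {x : V → ℝ}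
    (hx : ∀ S, ∑ e ∈ S, x e ≤ rnk M S) (e : V) :
    ∃ T, Tight M x T ∧ e ∉ T ∧ ∀ S, Tight M x S → e ∉ S → S ⊆ T := by
  classical
  obtain ⟨T, hT, hmax⟩ := Finset.exists_max_image
    (univ.filter (fun S : Finset V => Tight M x S ∧ e ∉ S)) Finset.card
    ⟨∅, by simp [tight_empty hM]⟩
  simp only [mem_filter, mem_univ, true_and] at hT hmax
  refine ⟨T, hT.1, hT.2, fun S hS heS => ?_⟩
  have := hmax (T ∪ S) ⟨(tight_union_inter hM hx hT.1 hS).1, by simp [hT.2, heS]⟩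
  have h2 := eq_of_subset_of_card_le (subset_union_left (s₂ := S)) this
  rw [h2]; exact subset_union_right

theorem exists_min_tight {M : Finset V → Prop} (hM : IsMatroid M) {x : V → ℝ}
    (hx : ∀ S, ∑ e ∈ S, x e ≤ rnk M S) (e : V) (he : lbl M x e ≠ ∅) :
    ∃ T, Tight M x T ∧ e ∈ T ∧ ∀ S, Tight M x S → e ∈ S → T ⊆ S := by
  classical
  obtain ⟨T, hT, hmin⟩ := Finset.exists_min_image _ Finset.card (nonempty_iff_ne_empty.2 he)
  simp only [mem_lbl] at hT hmin
  refine ⟨T, hT.1, hT.2, fun S hS heS => ?_⟩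
  have := hmin (T ∩ S) ⟨(tight_union_inter hM hx hT.1 hS).2, by simp [hT.2, heS]⟩
  have h2 := eq_of_subset_of_card_le (inter_subset_left (s₁ := T) (s₂ := S)) this
  rw [← h2]; exact inter_subset_right

theorem lbl_deg {M : Finset V → Prop} (hM : IsMatroid M) {x : V → ℝ}
    (hx0 : ∀ e, 0 ≤ x e) (hx1 : ∀ e, x e ≤ 1)
    (hx : ∀ S, ∑ e ∈ S, x e ≤ rnk M S) (e : V) (h0 : 0 < x e) (h1 : x e < 1)
    (he : lbl M x e ≠ ∅) :
    ∃ f, (0 < x f ∧ x f < 1) ∧ f ≠ e ∧ lbl M x f = lbl M x e := by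
  by_contra hcon
  push Not at hcon
  obtain ⟨D, hD, heD, hDmin⟩ := exists_min_tight hM hx e he
  obtain ⟨T, hT, heT, hTmax⟩ := exists_max_tight hM hx e
  have hcls : ∀ f ∈ D \ T, lbl M x f = lbl M x e := by
    intro f hf
    rw [mem_sdiff] at hf
    ext S
    simp only [mem_lbl]
    constructor
    · rintro ⟨hS, hfS⟩
      refine ⟨hS, ?_⟩
      by_contra heS
      exact hf.2 (hTmax S hS heS hfS)
    · rintro ⟨hS, heS⟩
      exact ⟨hS, hDmin S hS heS hf.1⟩
  have hint : ∑ f ∈ D \ T, x f = (rnk M D : ℝ) - rnk M (D ∩ T) := by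
    have h3 := (tight_union_inter hM hx hD hT).2
    unfold Tight at hD h3
    rw [← hD, ← h3, ← sum_inter_add_sum_sdiff D T]; ring
  have hsplit := Finset.add_sum_erase (D \ T) x (mem_sdiff.2 ⟨heD, heT⟩)
  have hrest : ∀ f ∈ (D \ T).erase e, x f = ((if x f = 1 then 1 else 0 : ℤ) : ℝ) := by
    intro f hf
    rw [mem_erase] at hf
    have hl := hcls f hf.2
    by_cases h : x f = 1
    · simp [h]
    · rw [if_neg h]
      have hlt := lt_of_le_of_ne (hx1 f) h
      rcases (hx0 f).lt_or_eq with h' | h'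
      · exact absurd hl (hcon f ⟨h', hlt⟩ hf.1)
      · simp [← h']
  rw [sum_congr rfl hrest, hint, ← Int.cast_sum] at hsplit
  generalize (∑ f ∈ (D \ T).erase e, (if x f = 1 then 1 else 0 : ℤ)) = m at hsplit
  have hxe : x e = (((rnk M D : ℤ) - rnk M (D ∩ T) - m : ℤ) : ℝ) := by
    push_cast; linarith
  rw [hxe] at h0 h1
  have a1 : (0:ℤ) < (rnk M D : ℤ) - rnk M (D ∩ T) - m := by exact_mod_cast h0
  have a2 : (rnk M D : ℤ) - rnk M (D ∩ T) - m < 1 := by exact_mod_cast h1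
  omega

theorem indep_of_lbl {M : Finset V → Prop} (hM : IsMatroid M) {x : V → ℝ}
    (hx : ∀ S, ∑ e ∈ S, x e ≤ rnk M S) (R : Finset V) (hpos : ∀ e ∈ R, 0 < x e)
    (hinj : ∀ e ∈ R, ∀ f ∈ R, e ≠ f → lbl M x e ≠ lbl M x f) : M R := by
  induction h : R.card generalizing R with
  | zero => rw [card_eq_zero.1 h]; exact hM.1
  | succ n ih =>
    obtain ⟨e, heR, hmin⟩ := Finset.exists_min_image R (fun e => (lbl M x e).card)
      (card_pos.1 (by omega))
    have hind : M (R.erase e) := ih _ (fun f hf => hpos f (mem_of_mem_erase hf))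
      (fun f hf g hg => hinj f (mem_of_mem_erase hf) g (mem_of_mem_erase hg))
      (by rw [card_erase_of_mem heR]; omega)
    obtain ⟨T, hT, heT, hTmax⟩ := exists_max_tight hM hx e
    have hsub : R.erase e ⊆ T := by
      intro f hf
      have hfR := mem_of_mem_erase hf
      have hne := hinj f hfR e heR (ne_of_mem_erase hf)
      have : ¬ lbl M x f ⊆ lbl M x e := fun hs => hne (eq_of_subset_of_card_le hs (hmin f hfR))
      rw [not_subset] at this
      obtain ⟨S, hS, hSe⟩ := this
      rw [mem_lbl] at hS hSe
      exact hTmax S hS.1 (fun h => hSe ⟨hS.1, h⟩) hS.2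
    obtain ⟨I, hI, hRI, hIT, hIc⟩ := exists_base hM hind hsub
    have hr : rnk M T < rnk M (insert e T) := by
      have h1 := hx (insert e T)
      rw [sum_insert heT] at h1
      unfold Tight at hT
      have h2 := hpos e heR
      have : (rnk M T : ℝ) < rnk M (insert e T) := by linarith
      exact_mod_cast this
    obtain ⟨K, hK, hKs, hKc⟩ := exists_rnk hM (insert e T)
    obtain ⟨y, hyK, hyI, hy⟩ := hM.2.2 hI hK (by omega)
    have hye : y = e := by
      by_contra hne
      have hyT : y ∈ T := (mem_insert.1 (hKs hyK)).resolve_left hne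
      have := card_le_rnk hy (insert_subset hyT hIT)
      rw [card_insert_of_notMem hyI] at this
      omega
    subst hye
    refine hM.2.1 hy ?_
    rw [← insert_erase heR]
    exact insert_subset_insert _ hRI

/-! ### Moving -/

theorem move_aux {ι : Type*} [Fintype ι] (a b : ι → ℝ) (ha : ∀ i, 0 ≤ a i)
    (hab : ∀ i, a i = 0 → b i = 0) (hb : ∃ i, b i < 0) :
    ∃ t : ℝ, 0 < t ∧ (∀ i, 0 ≤ a i + t * b i) ∧ ∃ i, a i ≠ 0 ∧ b i ≠ 0 ∧ a i + t * b i = 0 := by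
  classical
  obtain ⟨i, hi, hmin⟩ := Finset.exists_min_image (univ.filter (fun i => b i < 0))
    (fun i => a i / (- b i)) (by obtain ⟨i, hi⟩ := hb; exact ⟨i, by simp [hi]⟩)
  simp only [mem_filter, mem_univ, true_and] at hi hmin
  have hai : a i ≠ 0 := fun h => by have := hab i h; linarith
  have hai' : 0 < a i := lt_of_le_of_ne (ha i) hai.symm
  have ht : 0 < a i / (- b i) := div_pos hai' (by linarith)
  refine ⟨a i / (- b i), ht, fun j => ?_, i, hai, hi.ne, ?_⟩
  · by_cases hj : b j < 0
    · have := hmin j hj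
      rw [le_div_iff₀ (by linarith)] at this
      linarith
    · have := mul_nonneg ht.le (not_lt.1 hj)
      linarith [ha j]
  · have : b i ≠ 0 := hi.ne
    field_simp
    ring

/-- slack of the constraints -/
noncomputable def slack (M : Bool → Finset V → Prop) (x : V → ℝ) : V ⊕ (Bool × Finset V) → ℝ
  | Sum.inl e => x e
  | Sum.inr (b, S) => rnk (M b) S - ∑ e ∈ S, x e

def slopeD (d : V → ℝ) : V ⊕ (Bool × Finset V) → ℝ
  | Sum.inl e => d e
  | Sum.inr (_, S) => - ∑ e ∈ S, d e

def Ker (M : Bool → Finset V → Prop) (x d : V → ℝ) : Prop :=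
  ∀ i, slack M x i = 0 → slopeD d i = 0

theorem slack_add (M : Bool → Finset V → Prop) (x d : V → ℝ) (t : ℝ) (i) :
    slack M (fun e => x e + t * d e) i = slack M x i + t * slopeD d i := by
  rcases i with e | ⟨b, S⟩
  · simp [slack, slopeD]
  · simp [slack, slopeD, sum_add_distrib, ← mul_sum]; ring

theorem inPoly_iff (M : Bool → Finset V → Prop) (x : V → ℝ) :
    InPoly M x ↔ ∀ i, 0 ≤ slack M x i := by
  constructor
  · rintro h (e | ⟨b, S⟩)
    · exact h.nonneg e
    · have := h.le b S
      simp only [slack]; linarith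
  · intro h
    refine ⟨fun e => h (Sum.inl e), fun b S => ?_⟩
    have := h (Sum.inr (b, S))
    simp only [slack] at this; linarith

theorem move (M : Bool → Finset V → Prop) (x d : V → ℝ) (hx : InPoly M x) (hd : Ker M x d)
    (hd0 : d ≠ 0) : ∃ t : ℝ, 0 < t ∧ InPoly M (fun e => x e + t * d e) ∧
      (∀ i, slack M x i = 0 → slack M (fun e => x e + t * d e) i = 0) ∧
      ∃ i, slack M x i ≠ 0 ∧ slopeD d i ≠ 0 ∧ slack M (fun e => x e + t * d e) i = 0 := by
  rw [inPoly_iff] at hx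
  have hb : ∃ i, slopeD d i < 0 := by
    obtain ⟨e, he⟩ := Function.ne_iff.1 hd0
    rcases lt_or_gt_of_ne he with h | h
    · exact ⟨Sum.inl e, h⟩
    · refine ⟨Sum.inr (true, {e}), ?_⟩
      simp only [slopeD, sum_singleton]
      simp at h; linarith
  obtain ⟨t, ht, h1, i, h2, h3, h4⟩ := move_aux (slack M x) (slopeD d) hx hd hb
  refine ⟨t, ht, ?_, ?_, i, h2, h3, ?_⟩
  · rw [inPoly_iff]; intro i; rw [slack_add]; exact h1 i
  · intro j hj; rw [slack_add, hj, hd j hj]; simp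
  · rw [slack_add]; exact h4
theorem IsPath.far {Γ : Type*} {F : Finset V} {lab : Bool → V → Γ} {s : Bool} {L : ℕ}
    {e : ℕ → V} {v : ℕ → Γ} (h : IsPath F lab s L e v) (i j : ℕ) (hij : i + 2 ≤ j) (hj : j < L)
    (b : Bool) : lab b (e i) ≠ lab b (e j) := by
  have key : ∀ m < L, ∃ a, m ≤ a ∧ a ≤ m+1 ∧ b = xor s (Nat.bodd a) ∧ lab b (e m) = v a := by
    intro m hm
    by_cases hb : b = xor s (Nat.bodd m)
    · exact ⟨m, le_rfl, by omega, hb, by rw [hb]; exact h.left m hm⟩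
    · have hb' : b = xor s (Nat.bodd (m+1)) := by
        rw [Nat.bodd_succ]
        revert hb; cases b <;> cases s <;> cases Nat.bodd m <;> simp
      exact ⟨m+1, by omega, le_rfl, hb', by rw [hb']; exact h.right m hm⟩
  obtain ⟨a, h1, h2, h3, h4⟩ := key i (by omega)
  obtain ⟨a', h1', h2', h3', h4'⟩ := key j hj
  rw [h4, h4']
  refine h.ne a a' (by omega) (by omega) ?_
  rw [h3] at h3'
  revert h3'; cases s <;> cases Nat.bodd a <;> cases Nat.bodd a' <;> simp

theorem sum_ite_comm (A X : Finset V) :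
    ∑ v ∈ A, (if v ∈ X then (1:ℝ) else 0) = ∑ v ∈ X, if v ∈ A then (1:ℝ) else 0 := by
  rw [Finset.sum_ite_mem, Finset.sum_ite_mem, inter_comm]

/-- An alternating structure carrying a direction of the kernel. -/
structure Dir (M : Bool → Finset V → Prop) (x : V → ℝ) (k : ℕ) (tt ss : ℕ → V)
    (Cs : Finset V) : Prop where
  tinj : ∀ i < k+1, ∀ j < k+1, tt i = tt j → i = j
  sinj : ∀ i < k, ∀ j < k, ss i = ss j → i = j
  cs : Cs.card ≤ 1
  tsne : ∀ i < k+1, ∀ j < k, tt i ≠ ss j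
  tc : ∀ i < k+1, tt i ∉ Cs
  sc : ∀ i < k, ss i ∉ Cs
  tF : ∀ i < k+1, 0 < x (tt i) ∧ x (tt i) < 1
  sF : ∀ i < k, 0 < x (ss i) ∧ x (ss i) < 1
  cF : ∀ c ∈ Cs, 0 < x c ∧ x c < 1
  bal : ∀ b S, Tight (M b) x S → ∑ i ∈ range (k+1), (if tt i ∈ S then (1:ℝ) else 0) =
    ∑ i ∈ range k, (if ss i ∈ S then (1:ℝ) else 0) + ∑ c ∈ Cs, (if c ∈ S then (1:ℝ) else 0)
  ttne : ∀ b, ∀ i < k+1, ∀ j < k+1, i ≠ j → lbl (M b) x (tt i) ≠ lbl (M b) x (tt j)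
  ssne : ∀ b, ∀ i < k, ∀ j < k, i ≠ j → lbl (M b) x (ss i) ≠ lbl (M b) x (ss j)
  tslne : ∀ b, ∀ i, ∀ j < k, i < j → lbl (M b) x (tt i) ≠ lbl (M b) x (ss j)

theorem exists_dir {M : Bool → Finset V → Prop} (hM : ∀ b, IsMatroid (M b)) {x : V → ℝ}
    (hx : InPoly M x) (hx1 : ∀ e, x e ≤ 1) (hne : ∃ e, 0 < x e ∧ x e < 1) :
    ∃ k tt ss Cs, Dir M x k tt ss Cs := by
  classical
  let F : Finset V := univ.filter (fun e => 0 < x e ∧ x e < 1)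
  have hF : ∀ {e}, e ∈ F ↔ 0 < x e ∧ x e < 1 := by simp [F]
  obtain ⟨s, k, e, v, hp, hend⟩ := path_exists F (by obtain ⟨e, he⟩ := hne; exact ⟨e, hF.2 he⟩)
    (fun b e => lbl (M b) x e) ∅ (by
      intro b e he hl
      obtain ⟨f, h1, h2, h3⟩ := lbl_deg (hM b) hx.nonneg hx1 (hx.le b) e (hF.1 he).1 (hF.1 he).2 hl
      exact ⟨f, hF.2 h1, h2, h3⟩)
  obtain ⟨Cs, hCc, hCF, hCe, hCl, hCz⟩ : ∃ Cs : Finset V, Cs.card ≤ 1 ∧ (∀ c ∈ Cs, c ∈ F) ∧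
      (∀ c ∈ Cs, ∀ i < 2*k+1, c ≠ e i) ∧
      (∀ S, Tight (M s) x S → ∑ c ∈ Cs, (if c ∈ S then (1:ℝ) else 0) = if S ∈ v 0 then 1 else 0) ∧
      (∀ S, Tight (M (!s)) x S → ∑ c ∈ Cs, (if c ∈ S then (1:ℝ) else 0)
        = if S ∈ v (2*k+1) then 1 else 0) := by
    rcases hend with ⟨h0, h1⟩ | ⟨c, hc, h1, h2, h3⟩
    · exact ⟨∅, by simp, by simp, by simp, by simp [h0], by simp [h1]⟩
    · refine ⟨{c}, by simp, by simpa using hc, by simpa using h1, ?_, ?_⟩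
      · intro S hS
        have h4 : S ∈ v 0 ↔ c ∈ S := by rw [← h2]; simp only [mem_lbl, hS, true_and]
        simp only [sum_singleton, h4]
      · intro S hS
        have h4 : S ∈ v (2*k+1) ↔ c ∈ S := by rw [← h3]; simp only [mem_lbl, hS, true_and]
        simp only [sum_singleton, h4]
  have hinj : ∀ i < 2*k+1, ∀ j < 2*k+1, e i = e j → i = j := by
    intro i hi j hj hij
    rcases lt_trichotomy i j with h | h | h
    · exact absurd hij (hp.inj i j h hj)
    · exact h
    · exact absurd hij.symm (hp.inj j i h hi)
  have hfar : ∀ b, ∀ i < 2*k+1, ∀ j < 2*k+1, (i + 2 ≤ j ∨ j + 2 ≤ i) →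
      lbl (M b) x (e i) ≠ lbl (M b) x (e j) := by
    intro b i hi j hj hij
    rcases hij with h | h
    · exact hp.far i j h hj b
    · exact (hp.far j i h hi b).symm
  refine ⟨k, fun i => e (2*i), fun i => e (2*i+1), Cs, ?_⟩
  constructor
  · intro i hi j hj h
    have := hinj _ (by omega) _ (by omega) h
    omega
  · intro i hi j hj h
    have := hinj _ (by omega) _ (by omega) h
    omega
  · exact hCc
  · intro i hi j hj h
    have := hinj _ (by omega) _ (by omega) h
    omega
  · intro i hi h
    exact hCe _ h _ (by omega) rfl
  · intro i hi h
    exact hCe _ h _ (by omega) rfl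
  · intro i hi; exact hF.1 (hp.mem _ (by omega))
  · intro i hi; exact hF.1 (hp.mem _ (by omega))
  · intro c hc; exact hF.1 (hCF c hc)
  · intro b S hS
    have hmem : ∀ a, a ∈ S ↔ S ∈ lbl (M b) x a := by intro a; simp [mem_lbl, hS]
    by_cases hb : b = s
    · subst hb
      rw [hCl S hS, Finset.sum_range_succ']
      congr 1
      · refine sum_congr rfl fun i hi => ?_
        rw [mem_range] at hi
        have h1 := hp.left (2*(i+1)) (by omega)
        have h2 := hp.right (2*i+1) (by omega)
        simp only [Nat.bodd_succ, Nat.bodd_mul, Nat.bodd_two, Nat.bodd_zero, Bool.not_not, Bool.false_and, Bool.not_false,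
          Bool.not_true, Bool.xor_false] at h1 h2
        simp only [hmem, h1, h2]
        rfl
      · have h1 := hp.left 0 (by omega)
        simp only [Nat.bodd_zero, Bool.xor_false] at h1
        simp only [hmem, mul_zero, h1]
    · obtain rfl : b = !s := by revert hb; cases b <;> cases s <;> simp
      rw [hCz S hS, Finset.sum_range_succ]
      congr 1
      · refine sum_congr rfl fun i hi => ?_
        rw [mem_range] at hi
        have h1 := hp.right (2*i) (by omega)
        have h2 := hp.left (2*i+1) (by omega)
        simp only [Nat.bodd_succ, Nat.bodd_mul, Nat.bodd_two, Nat.bodd_zero, Bool.not_not, Bool.false_and, Bool.not_false,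
          Bool.not_true, Bool.xor_true] at h1 h2
        simp only [hmem, h1, h2]
      · have h1 := hp.right (2*k) (by omega)
        simp only [Nat.bodd_succ, Nat.bodd_mul, Nat.bodd_two, Nat.bodd_zero, Bool.not_not, Bool.false_and, Bool.not_false,
          Bool.not_true, Bool.xor_true] at h1
        simp only [hmem, h1]
  · intro b i hi j hj hij
    exact hfar b _ (by omega) _ (by omega) (by omega)
  · intro b i hi j hj hij
    exact hfar b _ (by omega) _ (by omega) (by omega)
  · intro b i j hj hij
    exact hfar b _ (by omega) _ (by omega) (by omega)

def dvec (k : ℕ) (tt ss : ℕ → V) (Cs : Finset V) : V → ℝ := fun v =>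
  (if v ∈ (range (k+1)).image tt then 1 else 0) - (if v ∈ (range k).image ss ∪ Cs then 1 else 0)

theorem Dir.sum_t {M : Bool → Finset V → Prop} {x : V → ℝ} {k : ℕ} {tt ss : ℕ → V}
    {Cs : Finset V} (h : Dir M x k tt ss Cs) (A : Finset V) :
    ∑ v ∈ A, (if v ∈ (range (k+1)).image tt then (1:ℝ) else 0) =
      ∑ i ∈ range (k+1), if tt i ∈ A then (1:ℝ) else 0 := by
  rw [sum_ite_comm, sum_image]
  intro i hi j hj hij
  simp only [coe_range, Set.mem_Iio] at hi hj
  exact h.tinj i hi j hj hij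

theorem Dir.sum_s {M : Bool → Finset V → Prop} {x : V → ℝ} {k : ℕ} {tt ss : ℕ → V}
    {Cs : Finset V} (h : Dir M x k tt ss Cs) (A : Finset V) :
    ∑ v ∈ A, (if v ∈ (range k).image ss ∪ Cs then (1:ℝ) else 0) =
      (∑ i ∈ range k, if ss i ∈ A then (1:ℝ) else 0) + ∑ c ∈ Cs, if c ∈ A then (1:ℝ) else 0 := by
  rw [sum_ite_comm, sum_union, sum_image]
  · intro i hi j hj hij
    simp only [coe_range, Set.mem_Iio] at hi hj
    exact h.sinj i hi j hj hij
  · rw [disjoint_left]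
    intro a ha
    rw [mem_image] at ha
    obtain ⟨i, hi, rfl⟩ := ha
    exact h.sc i (mem_range.1 hi)

theorem Dir.ker {M : Bool → Finset V → Prop} {x : V → ℝ} {k : ℕ} {tt ss : ℕ → V}
    {Cs : Finset V} (h : Dir M x k tt ss Cs) : Ker M x (dvec k tt ss Cs) := by
  rintro (e | ⟨b, S⟩) hi
  · simp only [slack] at hi
    simp only [slopeD, dvec]
    rw [if_neg, if_neg]
    · simp
    · intro hc
      rw [mem_union, mem_image] at hc
      rcases hc with ⟨i, hi', rfl⟩ | hc
      · have := h.sF i (mem_range.1 hi'); linarith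
      · have := h.cF e hc; linarith
    · intro hc
      rw [mem_image] at hc
      obtain ⟨i, hi', rfl⟩ := hc
      have := h.tF i (mem_range.1 hi'); linarith
  · simp only [slack] at hi
    simp only [slopeD, dvec]
    rw [sum_sub_distrib, h.sum_t, h.sum_s, h.bal b S (by unfold Tight; linarith)]
    simp

theorem Dir.t0 {M : Bool → Finset V → Prop} {x : V → ℝ} {k : ℕ} {tt ss : ℕ → V}
    {Cs : Finset V} (h : Dir M x k tt ss Cs) {v : V} (hv : v ∈ (range (k+1)).image tt) :
    v ∉ (range k).image ss ∪ Cs := by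
  rw [mem_image] at hv
  obtain ⟨i, hi, rfl⟩ := hv
  rw [mem_range] at hi
  rw [mem_union, mem_image]
  rintro (⟨j, hj, hc⟩ | hc)
  · exact h.tsne i hi j (mem_range.1 hj) hc.symm
  · exact h.tc i hi hc

theorem Dir.ne_zero {M : Bool → Finset V → Prop} {x : V → ℝ} {k : ℕ} {tt ss : ℕ → V}
    {Cs : Finset V} (h : Dir M x k tt ss Cs) : dvec k tt ss Cs ≠ 0 := by
  intro hc
  have := congrFun hc (tt 0)
  have h0 : tt 0 ∈ (range (k+1)).image tt := mem_image_of_mem _ (by simp)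
  simp only [dvec, if_pos h0, if_neg (h.t0 h0)] at this
  simp at this

theorem ivt_up (h : ℕ → ℤ) (k : ℕ) (hs : ∀ j < k, |h (j+1) - h j| ≤ 1) (m : ℤ) (h0 : h 0 ≤ m)
    (hk : m ≤ h k) : ∃ j ≤ k, h j = m := by
  induction k with
  | zero => exact ⟨0, le_rfl, by omega⟩
  | succ k ih =>
    by_cases hm : m ≤ h k
    · obtain ⟨j, hj, e⟩ := ih (fun j hj => hs j (by omega)) hm
      exact ⟨j, by omega, e⟩
    · have := hs k (by omega)
      rw [abs_le] at this
      exact ⟨k+1, le_rfl, by omega⟩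

theorem ivt (h : ℕ → ℤ) (k : ℕ) (hs : ∀ j < k, |h (j+1) - h j| ≤ 1) (m : ℤ)
    (hm : (h 0 ≤ m ∧ m ≤ h k) ∨ (h k ≤ m ∧ m ≤ h 0)) : ∃ j ≤ k, h j = m := by
  rcases hm with ⟨h1, h2⟩ | ⟨h1, h2⟩
  · exact ivt_up h k hs m h1 h2
  · obtain ⟨j, hj, e⟩ := ivt_up (fun i => - h i) k (fun j hj => by
      have := hs j hj
      rw [abs_le] at this ⊢
      constructor <;> linarith) (-m) (by simpa using h2) (by simpa using h1)
    exact ⟨j, hj, by simpa using e⟩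
theorem tight_singleton {M : Finset V → Prop} (hM : IsMatroid M) {x : V → ℝ}
    (hx : ∀ S, ∑ e ∈ S, x e ≤ rnk M S) {e : V} (he : x e = 1) : Tight M x {e} := by
  unfold Tight
  have h1 := hx {e}
  have h2 : (rnk M {e} : ℝ) ≤ 1 := by exact_mod_cast rnk_le_card hM {e}
  rw [sum_singleton] at *
  linarith

theorem lbl_ne_of_one {M : Finset V → Prop} (hM : IsMatroid M) {x : V → ℝ}
    (hx : ∀ S, ∑ e ∈ S, x e ≤ rnk M S) {e f : V} (he : x e = 1) (hef : e ≠ f) :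
    lbl M x e ≠ lbl M x f := by
  intro h
  have : {e} ∈ lbl M x e := mem_lbl.2 ⟨tight_singleton hM hx he, by simp⟩
  rw [h, mem_lbl] at this
  simp at this
  exact hef this.2.symm

theorem card_inter_eq (S A : Finset V) :
    ((S ∩ A).card : ℤ) = ∑ v ∈ S, if v ∈ A then (1:ℤ) else 0 := by
  rw [Finset.sum_ite_mem]; simp

theorem round_main {M : Bool → Finset V → Prop} (hM : ∀ b, IsMatroid (M b)) {x : V → ℝ}
    (hx : InPoly M x) (hx1 : ∀ y, InPoly M y → ∀ e, y e ≤ 1) (A B : Finset V)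
    (hdisj : Disjoint A B) (hcover : A ∪ B = Finset.univ)
    (hker : ∀ d, Ker M x d → ∑ e ∈ A, d e = 0 → d = 0) :
    ∃ S : Finset V, (∀ b, M b S) ∧ ∑ e ∈ A, x e < ((S ∩ A).card : ℤ) + 2 ∧
      ∑ e ∈ B, x e < ((S ∩ B).card : ℤ) + 2 := by
  classical
  set O : Finset V := univ.filter (fun e => x e = 1) with hO
  have hOm : ∀ {e}, e ∈ O ↔ x e = 1 := by simp [hO]
  by_cases hne : ∃ e, 0 < x e ∧ x e < 1
  swap
  · push Not at hne
    have hval : ∀ e, x e = if e ∈ O then 1 else 0 := by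
      intro e
      split_ifs with h
      · exact hOm.1 h
      · rcases (hx.nonneg e).lt_or_eq with h' | h'
        · exact absurd (hOm.2 (le_antisymm (hx1 x hx e) (hne e h'))) h
        · exact h'.symm
    have hs : ∀ A : Finset V, ∑ e ∈ A, x e < ((O ∩ A).card : ℤ) + 2 := by
      intro A
      rw [card_inter_eq, sum_congr rfl (fun e _ => hval e), sum_ite_comm]
      push_cast
      linarith
    refine ⟨O, fun b => ?_, hs A, hs B⟩
    refine indep_of_lbl (hM b) (hx.le b) O (fun e he => by rw [hOm.1 he]; norm_num) ?_
    intro e he f hf hef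
    exact lbl_ne_of_one (hM b) (hx.le b) (hOm.1 he) hef
  obtain ⟨k, tt, ss, Cs, hD⟩ := exists_dir hM hx (hx1 x hx) hne
  set d := dvec k tt ss Cs with hd
  obtain ⟨t, ht, hy, hact, i0, hi1, hi2, hi3⟩ := move M x d hx hD.ker hD.ne_zero
  set y : V → ℝ := fun e => x e + t * d e with hydef
  -- y is integral
  have hdA : ∑ e ∈ A, d e ≠ 0 := fun h => hD.ne_zero (hker d hD.ker h)
  have hyint : ¬ ∃ e, 0 < y e ∧ y e < 1 := by
    intro hne'
    obtain ⟨k', tt', ss', Cs', hD'⟩ := exists_dir hM hy (hx1 y hy) hne'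
    set d' := dvec k' tt' ss' Cs' with hd'
    have hk1 : Ker M y d' := hD'.ker
    have hk2 : Ker M x d' := fun i hi => hk1 i (hact i hi)
    have slin : ∀ (a b : ℝ) (i), slopeD (fun e => a * d e + b * d' e) i =
        a * slopeD d i + b * slopeD d' i := by
      intro a b i
      rcases i with e | ⟨b, S⟩
      · simp [slopeD]
      · simp [slopeD, sum_add_distrib, ← mul_sum]; ring
    have h0 := hker (fun e => (∑ e ∈ A, d' e) * d e + (- ∑ e ∈ A, d e) * d' e) (by
      intro i hi
      rw [slin, hD.ker i hi, hk2 i hi]; simp) (by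
      rw [sum_add_distrib, ← mul_sum, ← mul_sum]; ring)
    by_cases hz : ∑ e ∈ A, d' e = 0
    · exact hD'.ne_zero (hker d' hk2 hz)
    · have h1 := slin (∑ e ∈ A, d' e) (- ∑ e ∈ A, d e) i0
      rw [h0, hk1 i0 hi3] at h1
      have : slopeD (0 : V → ℝ) i0 = 0 := by
        rcases i0 with e | ⟨b, S⟩ <;> simp [slopeD]
      rw [this] at h1
      simp only [mul_zero, add_zero] at h1
      rcases mul_eq_zero.1 h1.symm with h | h
      · exact hz h
      · exact hi2 h
  push Not at hyint
  have hy01 : ∀ e, y e = 0 ∨ y e = 1 := by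
    intro e
    rcases (hy.nonneg e).lt_or_eq with h' | h'
    · exact Or.inr (le_antisymm (hx1 y hy e) (hyint e h'))
    · exact Or.inl h'.symm
  set Te := (range (k+1)).image tt with hTe
  set So := (range k).image ss ∪ Cs with hSo
  have hdv : ∀ e, d e = (if e ∈ Te then 1 else 0) - (if e ∈ So then 1 else 0) := fun e => rfl
  have hTF : ∀ e ∈ Te, 0 < x e ∧ x e < 1 := by
    intro e he
    obtain ⟨i, hi, rfl⟩ := mem_image.1 he
    exact hD.tF i (mem_range.1 hi)
  have hSF : ∀ e ∈ So, 0 < x e ∧ x e < 1 := by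
    intro e he
    rcases mem_union.1 he with he | he
    · obtain ⟨i, hi, rfl⟩ := mem_image.1 he
      exact hD.sF i (mem_range.1 hi)
    · exact hD.cF e he
  have hTx : ∀ e ∈ Te, x e = 1 - t := by
    intro e he
    have h1 : y e = x e + t * d e := rfl
    rw [hdv, if_pos he, if_neg (hD.t0 he)] at h1
    have := hTF e he
    rcases hy01 e with h | h <;> linarith
  have hSx : ∀ e ∈ So, x e = t := by
    intro e he
    have h1 : y e = x e + t * d e := rfl
    have hn : e ∉ Te := fun h => hD.t0 h he
    rw [hdv, if_pos he, if_neg hn] at h1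
    have := hSF e he
    rcases hy01 e with h | h <;> linarith
  have hxval : ∀ e, x e = (if e ∈ O then 1 else 0) + (1-t) * (if e ∈ Te then 1 else 0)
      + t * (if e ∈ So then 1 else 0) := by
    intro e
    by_cases h1 : e ∈ Te
    · have hn : e ∉ O := fun h => by have := hOm.1 h; have := hTF e h1; linarith
      rw [if_pos h1, if_neg hn, if_neg (hD.t0 h1), hTx e h1]; ring
    · by_cases h2 : e ∈ So
      · have hn : e ∉ O := fun h => by have := hOm.1 h; have := hSF e h2; linarith
        rw [if_neg h1, if_neg hn, if_pos h2, hSx e h2]; ring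
      · have h3 : y e = x e + t * d e := rfl
        rw [hdv, if_neg h1, if_neg h2] at h3
        rw [if_neg h1, if_neg h2]
        split_ifs with h
        · rw [hOm.1 h]; ring
        · have := hy01 e
          rw [hOm] at h
          rcases this with h4 | h4
          · linarith
          · exact absurd (by linarith) h
  have hsum : ∀ A : Finset V, ∑ e ∈ A, x e = (∑ e ∈ O, if e ∈ A then (1:ℝ) else 0)
      + (1-t) * (∑ i ∈ range (k+1), if tt i ∈ A then (1:ℝ) else 0)
      + t * ((∑ i ∈ range k, if ss i ∈ A then (1:ℝ) else 0)
        + ∑ c ∈ Cs, if c ∈ A then (1:ℝ) else 0) := by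
    intro A
    rw [sum_congr rfl (fun e _ => hxval e), sum_add_distrib, sum_add_distrib, ← mul_sum,
      ← mul_sum, sum_ite_comm, hD.sum_t, hD.sum_s]
  have ht1 : t < 1 := by
    have h0 : tt 0 ∈ Te := mem_image_of_mem _ (by simp)
    have := hTx _ h0
    have := hTF _ h0
    linarith
  -- the counts
  let N : Finset V → ℕ → ℤ := fun A j => (∑ e ∈ O, if e ∈ A then (1:ℤ) else 0)
    + ((∑ i ∈ range j, if tt i ∈ A then (1:ℤ) else 0)
      + ∑ i ∈ Ico j k, if ss i ∈ A then (1:ℤ) else 0)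
  have hstep : ∀ j < k, |N A (j+1) - N A j| ≤ 1 := by
    intro j hj
    simp only [N]
    rw [sum_range_succ, Finset.sum_eq_sum_Ico_succ_bot hj]
    rw [abs_le]
    constructor <;> split_ifs <;> linarith
  have hR : ∀ j ≤ k, ∃ S : Finset V, (∀ b, M b S) ∧ ∀ A, ((S ∩ A).card : ℤ) = N A j := by
    intro j hj
    have hOT : ∀ i < k+1, tt i ∉ O := fun i hi h => by
      have := hOm.1 h; have := hD.tF i hi; linarith
    have hOS : ∀ i < k, ss i ∉ O := fun i hi h => by
      have := hOm.1 h; have := hD.sF i hi; linarith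
    refine ⟨O ∪ ((range j).image tt ∪ (Ico j k).image ss), fun b => ?_, fun A => ?_⟩
    · have hmem : ∀ e, e ∈ O ∪ ((range j).image tt ∪ (Ico j k).image ss) →
          x e = 1 ∨ (∃ i < j, tt i = e) ∨ (∃ i, j ≤ i ∧ i < k ∧ ss i = e) := by
        intro e he
        simp only [mem_union, hOm, mem_image, mem_range, mem_Ico, and_assoc] at he
        exact he
      refine indep_of_lbl (hM b) (hx.le b) _ ?_ ?_
      · intro e he
        rcases hmem e he with h | ⟨i, hi, rfl⟩ | ⟨i, _, hi, rfl⟩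
        · rw [h]; norm_num
        · exact (hD.tF i (by omega)).1
        · exact (hD.sF i hi).1
      · intro e he f hf hef
        rcases hmem e he with h | ⟨i, hi, rfl⟩ | ⟨i, hi', hi, rfl⟩
        · exact lbl_ne_of_one (hM b) (hx.le b) h hef
        · rcases hmem f hf with h | ⟨m, hm, rfl⟩ | ⟨m, hm', hm, rfl⟩
          · exact (lbl_ne_of_one (hM b) (hx.le b) h hef.symm).symm
          · exact hD.ttne b i (by omega) m (by omega) (fun h => hef (by rw [h]))
          · exact hD.tslne b i m hm (by omega)
        · rcases hmem f hf with h | ⟨m, hm, rfl⟩ | ⟨m, hm', hm, rfl⟩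
          · exact (lbl_ne_of_one (hM b) (hx.le b) h hef.symm).symm
          · exact (hD.tslne b m i hi (by omega)).symm
          · exact hD.ssne b i (by omega) m (by omega) (fun h => hef (by rw [h]))
    · rw [card_inter_eq, sum_union, sum_union, sum_image, sum_image]
      · intro a ha b hb hab
        simp only [coe_Ico, Set.mem_Ico] at ha hb
        exact hD.sinj a ha.2 b hb.2 hab
      · intro a ha b hb hab
        simp only [coe_range, Set.mem_Iio] at ha hb
        exact hD.tinj a (by omega) b (by omega) hab
      · rw [disjoint_left]
        intro a ha hb
        simp only [mem_image, mem_range, mem_Ico] at ha hb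
        obtain ⟨i, hi, rfl⟩ := ha
        obtain ⟨m, hm, h⟩ := hb
        exact hD.tsne i (by omega) m hm.2 h.symm
      · rw [disjoint_left]
        intro a ha hb
        simp only [mem_union, mem_image, mem_range, mem_Ico] at hb
        rcases hb with ⟨i, hi, rfl⟩ | ⟨i, hi, rfl⟩
        · exact hOT i (by omega) ha
        · exact hOS i hi.2 ha
  have hpart : ∀ e, (if e ∈ A then (1:ℤ) else 0) + (if e ∈ B then (1:ℤ) else 0) = 1 := by
    intro e
    have h1 : e ∈ A ∪ B := by rw [hcover]; simp
    by_cases h : e ∈ A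
    · have := disjoint_left.1 hdisj h
      simp [h, this]
    · have := (mem_union.1 h1).resolve_left h
      simp [h, this]
  have hpartR : ∀ e, (if e ∈ A then (1:ℝ) else 0) + (if e ∈ B then (1:ℝ) else 0) = 1 := by
    intro e; have := hpart e; exact_mod_cast this
  have hNN : ∀ j ≤ k, N A j + N B j = O.card + k := by
    intro j hj
    have : N A j + N B j = (∑ e ∈ O, ((if e ∈ A then (1:ℤ) else 0) + (if e ∈ B then (1:ℤ) else 0)))
      + ((∑ i ∈ range j, ((if tt i ∈ A then (1:ℤ) else 0) + (if tt i ∈ B then (1:ℤ) else 0)))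
      + ∑ i ∈ Ico j k, ((if ss i ∈ A then (1:ℤ) else 0) + (if ss i ∈ B then (1:ℤ) else 0))) := by
      simp only [N, sum_add_distrib]; ring
    rw [this]
    simp only [hpart]
    simp
    omega
  have hxx : ∑ e ∈ A, x e + ∑ e ∈ B, x e ≤ O.card + k + 1 := by
    have : ∑ e ∈ A, x e + ∑ e ∈ B, x e =
      (∑ e ∈ O, ((if e ∈ A then (1:ℝ) else 0) + (if e ∈ B then (1:ℝ) else 0)))
      + (1-t) * (∑ i ∈ range (k+1), ((if tt i ∈ A then (1:ℝ) else 0) + (if tt i ∈ B then (1:ℝ) else 0)))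
      + t * ((∑ i ∈ range k, ((if ss i ∈ A then (1:ℝ) else 0) + (if ss i ∈ B then (1:ℝ) else 0)))
        + ∑ c ∈ Cs, ((if c ∈ A then (1:ℝ) else 0) + (if c ∈ B then (1:ℝ) else 0))) := by
      rw [hsum A, hsum B]; simp only [sum_add_distrib]; ring
    rw [this]
    simp only [hpartR]
    have hc : (Cs.card : ℝ) ≤ 1 := by exact_mod_cast hD.cs
    simp
    nlinarith
  -- convex combination
  set c : ℝ := t * N A 0 + (1-t) * N A k with hc
  have hcx : c ≤ ∑ e ∈ A, x e ∧ ∑ e ∈ A, x e ≤ c + 1 := by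
    rw [hsum A, sum_range_succ]
    have h1 : 0 ≤ (if tt k ∈ A then (1:ℝ) else 0) ∧ (if tt k ∈ A then (1:ℝ) else 0) ≤ 1 := by
      split_ifs <;> norm_num
    have h2 : 0 ≤ (∑ c ∈ Cs, if c ∈ A then (1:ℝ) else 0) ∧
        (∑ c ∈ Cs, if c ∈ A then (1:ℝ) else 0) ≤ 1 := by
      constructor
      · exact sum_nonneg fun _ _ => by split_ifs <;> norm_num
      · have h3 : (Cs.card : ℝ) ≤ 1 := by exact_mod_cast hD.cs
        have h4 : (∑ c ∈ Cs, if c ∈ A then (1:ℝ) else 0) ≤ ∑ c ∈ Cs, (1:ℝ) :=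
          sum_le_sum fun _ _ => by split_ifs <;> norm_num
        simp only [sum_const, nsmul_eq_mul, mul_one] at h4
        linarith
    have e1 : (N A 0 : ℝ) = (∑ e ∈ O, if e ∈ A then (1:ℝ) else 0)
        + ∑ i ∈ range k, if ss i ∈ A then (1:ℝ) else 0 := by
      have hI : Ico 0 k = range k := (range_eq_Ico k).symm
      simp [N, hI]
    have e2 : (N A k : ℝ) = (∑ e ∈ O, if e ∈ A then (1:ℝ) else 0)
        + ∑ i ∈ range k, if tt i ∈ A then (1:ℝ) else 0 := by
      simp [N]
    rw [hc, e1, e2]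
    constructor <;> nlinarith
  obtain ⟨j, hj, hNj⟩ := ivt (N A) k hstep ⌊c⌋ (by
    rcases le_total (N A 0) (N A k) with h | h
    · left
      have h' : (N A 0 : ℝ) ≤ N A k := by exact_mod_cast h
      constructor
      · apply Int.le_floor.2; rw [hc]; nlinarith
      · have : c ≤ (N A k : ℝ) := by rw [hc]; nlinarith
        have := (Int.floor_le c).trans this
        exact_mod_cast this
    · right
      have h' : (N A k : ℝ) ≤ N A 0 := by exact_mod_cast h
      constructor
      · apply Int.le_floor.2; rw [hc]; nlinarith
      · have : c ≤ (N A 0 : ℝ) := by rw [hc]; nlinarith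
        have := (Int.floor_le c).trans this
        exact_mod_cast this)
  obtain ⟨S, hS, hcard⟩ := hR j hj
  refine ⟨S, hS, ?_, ?_⟩
  · rw [hcard, hNj]
    have := Int.lt_floor_add_one c
    linarith [hcx.2]
  · have h1 := hNN j hj
    rw [hNj] at h1
    have h2 : ((⌊c⌋ : ℤ) : ℝ) + (N B j : ℝ) = O.card + k := by exact_mod_cast h1
    rw [hcard]
    have := Int.floor_le c
    linarith [hcx.1]

theorem exists_extreme {M : Bool → Finset V → Prop} (A B : Finset V) (α β : ℝ)
    (hex : ∃ x, InPoly M x ∧ α ≤ ∑ e ∈ A, x e ∧ β ≤ ∑ e ∈ B, x e) :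
    ∃ x, InPoly M x ∧ α ≤ ∑ e ∈ A, x e ∧ β ≤ ∑ e ∈ B, x e ∧
      ∀ d, Ker M x d → ∑ e ∈ A, d e = 0 → d = 0 := by
  classical
  let act : (V → ℝ) → Finset (V ⊕ (Bool × Finset V)) := fun x =>
    univ.filter (fun i => slack M x i = 0)
  let Pr : ℕ → Prop := fun n => ∃ x, (InPoly M x ∧ α ≤ ∑ e ∈ A, x e ∧ β ≤ ∑ e ∈ B, x e) ∧
    (act x).card = n
  have hbd : ∀ n, Pr n → n ≤ Fintype.card (V ⊕ (Bool × Finset V)) := by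
    rintro n ⟨x, _, rfl⟩
    exact card_le_univ _
  obtain ⟨x0, hx0⟩ := hex
  have hb : Pr (act x0).card := ⟨x0, hx0, rfl⟩
  obtain ⟨x, ⟨hx, hα, hβ⟩, hc⟩ := Nat.findGreatest_spec (hbd _ hb) hb
  refine ⟨x, hx, hα, hβ, ?_⟩
  have key : ∀ d, Ker M x d → ∑ e ∈ A, d e = 0 → 0 ≤ ∑ e ∈ B, d e → d = 0 := by
    intro d hd hdA hdB
    by_contra h0
    obtain ⟨t, ht, hy, hact, i, h1, h2, h3⟩ := move M x d hx hd h0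
    have hPr : Pr (act (fun e => x e + t * d e)).card := by
      refine ⟨_, ⟨hy, ?_, ?_⟩, rfl⟩
      · rw [sum_add_distrib, ← mul_sum, hdA]; linarith
      · rw [sum_add_distrib, ← mul_sum]
        have := mul_nonneg ht.le hdB
        linarith
    have h4 := Nat.le_findGreatest (hbd _ hPr) hPr
    have h5 : (act x).card < (act (fun e => x e + t * d e)).card := by
      apply card_lt_card
      rw [ssubset_iff_of_subset]
      · exact ⟨i, by simp [act, h3], by simp [act, h1]⟩
      · intro j hj
        simp only [act, mem_filter, mem_univ, true_and] at hj ⊢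
        exact hact j hj
    omega
  intro d hd hdA
  rcases le_total 0 (∑ e ∈ B, d e) with h | h
  · exact key d hd hdA h
  · have := key (fun e => - d e) (by
      intro i hi
      have := hd i hi
      rcases i with e | ⟨b, S⟩
      · simpa [slopeD] using this
      · simpa [slopeD] using this) (by simpa using hdA) (by simpa using h)
    funext e
    have := congrFun this e
    simpa using this

theorem zeta_bd {M : Finset V → Prop} (S : Finset V) (hS : S.Nonempty) :
    (S.card : ℝ) / rnk M S ≤ zeta M := by
  unfold zeta
  apply le_csSup
  · apply Set.Finite.bddAbove
    apply (Set.finite_range (fun S : Finset V => (S.card : ℝ) / (rnk M S : ℝ))).subset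
    rintro _ ⟨S, _, rfl⟩
    exact ⟨S, rfl⟩
  · exact ⟨S, hS, rfl⟩

/-- Main theorem: for two matroids `P, Q` on `V`, `|V| = n`, `ζ = max(ζ(P), ζ(Q))` and
`δ = 1/ζ - 1/n`, every partition of `V` into two sets has an almost `δ`-fair
representation by a set independent in both matroids. -/
theorem stmt7 [Nonempty V] (P Q : Finset V → Prop)
    (hP : IsMatroid P) (hQ : IsMatroid Q) (hPl : Loopless P) (hQl : Loopless Q)
    (A B : Finset V) (hdisj : Disjoint A B) (hcover : A ∪ B = Finset.univ) :
    ∃ S : Finset V, P S ∧ Q S ∧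
      (⌊(1 / max (zeta P) (zeta Q) - 1 / (Fintype.card V : ℝ)) * (A.card : ℝ)⌋ - 1
          ≤ ((S ∩ A).card : ℤ)) ∧
      (⌊(1 / max (zeta P) (zeta Q) - 1 / (Fintype.card V : ℝ)) * (B.card : ℝ)⌋ - 1
          ≤ ((S ∩ B).card : ℤ)) := by
  let M : Bool → Finset V → Prop := fun b => if b then P else Q
  have hM : ∀ b, IsMatroid (M b) := by intro b; cases b <;> simp [M, hP, hQ]
  have hMl : ∀ b v, M b {v} := by
    intro b v; cases b
    · simpa [M] using hQl v
    · simpa [M] using hPl v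
  set ζ := max (zeta P) (zeta Q) with hζ
  have hz : ∀ b, zeta (M b) ≤ ζ := by intro b; cases b <;> simp [M, hζ]
  have hrpos : ∀ b (S : Finset V), S.Nonempty → 0 < rnk (M b) S := by
    rintro b S ⟨v, hv⟩
    have := card_le_rnk (hMl b v) (singleton_subset_iff.2 hv)
    rw [card_singleton] at this
    omega
  have hζpos : 0 < ζ := by
    obtain ⟨v⟩ := ‹Nonempty V›
    have h1 := (zeta_bd (M := M true) {v} (singleton_nonempty v)).trans (hz true)
    have h2 := hrpos true {v} (singleton_nonempty v)
    have h3 : (0:ℝ) < (({v} : Finset V).card : ℝ) / rnk (M true) {v} :=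
      div_pos (by simp) (by exact_mod_cast h2)
    linarith
  have hpoly : InPoly M (fun _ => 1 / ζ) := by
    refine ⟨fun _ => by positivity, fun b S => ?_⟩
    rcases S.eq_empty_or_nonempty with rfl | hS
    · simp
    · have h1 := (zeta_bd (M := M b) S hS).trans (hz b)
      have h2 : (0:ℝ) < rnk (M b) S := by exact_mod_cast hrpos b S hS
      rw [div_le_iff₀ h2] at h1
      simp only [sum_const, nsmul_eq_mul]
      rw [mul_one_div, div_le_iff₀ hζpos]
      linarith
  obtain ⟨x, hx, hα, hβ, hker⟩ := exists_extreme (M := M) A B (A.card * (1/ζ)) (B.card * (1/ζ))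
    ⟨_, hpoly, by simp, by simp⟩
  obtain ⟨S, hS, h1, h2⟩ := round_main hM hx (fun y hy e => by
    have h1 := hy.le true {e}
    have h2 : (rnk (M true) {e} : ℝ) ≤ 1 := by exact_mod_cast rnk_le_card (hM true) {e}
    rw [sum_singleton] at h1
    linarith) A B hdisj hcover hker
  have fin : ∀ (X : Finset V) (c : ℤ), (X.card : ℝ) * (1/ζ) < c + 2 →
      ⌊(1 / ζ - 1 / (Fintype.card V : ℝ)) * (X.card : ℝ)⌋ - 1 ≤ c := by
    intro X c h
    have : ⌊(1 / ζ - 1 / (Fintype.card V : ℝ)) * (X.card : ℝ)⌋ < c + 2 := by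
      rw [Int.floor_lt]
      push_cast
      have : 0 ≤ 1 / (Fintype.card V : ℝ) * (X.card : ℝ) := by positivity
      linarith
    omega
  refine ⟨S, by simpa [M] using hS true, by simpa [M] using hS false, fin A _ ?_, fin B _ ?_⟩
  · exact lt_of_le_of_lt hα h1
  · exact lt_of_le_of_lt hβ h2
end

section
/- If C is a cycle graph and (A₁, …, A_m) is a partition of its vertex set, then there exists an independent set S of C (no two adjacent vertices) with |S ∩ A_i| ≥ |A_i|/2 − 1 for all i ≤ m. -/
open Finset

namespace Fair

variable {α : Type*} [DecidableEq α]

/-- Sum over all maximal flags below the sign vector `(P, N)` of `f` of the list of labels. -/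
def C (lab : Finset α → Finset α → ℤ) : ℕ → Finset α → Finset α → (List ℤ → ZMod 2) → ZMod 2
  | 0, _, _, f => f []
  | k+1, P, N, f => ∑ i ∈ P ∪ N, C lab k (P.erase i) (N.erase i) (fun l => f (lab P N :: l))

/-- The coboundary. -/
def dl : List ℤ → (List ℤ → ZMod 2) → ZMod 2
  | [], _ => 0
  | v :: l, f => f l + dl l (fun t => f (v :: t))

lemma C_add (lab : Finset α → Finset α → ℤ) (k : ℕ) : ∀ (P N : Finset α) (f g : List ℤ → ZMod 2),
    C lab k P N (fun l => f l + g l) = C lab k P N f + C lab k P N g := by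
  induction k with
  | zero => intros; rfl
  | succ k ih => intro P N f g; simp only [C, ih, Finset.sum_add_distrib]

lemma sum_erase_symm (T : Finset α) (G : α → α → ZMod 2) (hG : ∀ i j, G i j = G j i) :
    ∑ i ∈ T, ∑ j ∈ T.erase i, G i j = 0 := by
  rw [Finset.sum_sigma']
  refine Finset.sum_involution (fun x _ => ⟨x.2, x.1⟩) ?_ ?_ ?_ ?_
  · rintro ⟨i, j⟩ _
    simp only
    rw [hG i j]; exact CharTwo.add_self_eq_zero _
  · rintro ⟨i, j⟩ h _ h2
    simp only [Finset.mem_sigma, Finset.mem_erase] at h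
    simp only [Sigma.mk.injEq] at h2
    exact h.2.1 h2.1
  · rintro ⟨i, j⟩ h
    simp only [Finset.mem_sigma, Finset.mem_erase] at h ⊢
    exact ⟨h.2.2, fun e => h.2.1 e.symm, h.1⟩
  · rintro ⟨i, j⟩ _
    rfl

lemma C_dl (lab : Finset α → Finset α → ℤ) (k : ℕ) : ∀ (P N : Finset α) (f : List ℤ → ZMod 2),
    (P ∪ N).card = k + 1 →
    C lab (k+1) P N (fun l => dl l f) = ∑ i ∈ P ∪ N, C lab k (P.erase i) (N.erase i) f := by
  induction k with
  | zero =>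
    intro P N f _
    simp [C, dl]
  | succ k ih =>
    intro P N f h
    rw [C]
    simp only [dl]
    simp only [C_add, Finset.sum_add_distrib]
    have : ∑ i ∈ P ∪ N, C lab (k+1) (P.erase i) (N.erase i)
        (fun l => dl l (fun t => f (lab P N :: t))) = 0 := by
      rw [← sum_erase_symm (P ∪ N) (fun i j => C lab k ((P.erase i).erase j)
        ((N.erase i).erase j) (fun t => f (lab P N :: t)))]
      · refine Finset.sum_congr rfl fun i hi => ?_
        have he := Finset.erase_union_distrib P N i
        rw [ih, ← he]
        rw [← he, Finset.card_erase_of_mem hi, h]; rfl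
      · intro i j
        rw [Finset.erase_right_comm, Finset.erase_right_comm (s := N)]
    rw [this, add_zero]

/-- list of labels of a chain: no two complementary, all in the allowed set -/
def Good (L : Finset ℕ) (l : List ℤ) : Prop :=
  (∀ x ∈ l, x ≠ 0 ∧ x.natAbs ∈ L) ∧ (∀ x ∈ l, ∀ y ∈ l, x ≠ -y)

structure Lab (lab : Finset α → Finset α → ℤ) (T : Finset α) (L : Finset ℕ) : Prop where
  ne0 : ∀ P N, Disjoint P N → P ∪ N ⊆ T → (P ∪ N).Nonempty → lab P N ≠ 0
  mem : ∀ P N, Disjoint P N → P ∪ N ⊆ T → (P ∪ N).Nonempty → (lab P N).natAbs ∈ L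
  anti : ∀ P N, Disjoint P N → P ∪ N ⊆ T → (P ∪ N).Nonempty → lab N P = - lab P N
  comp : ∀ P N P' N', Disjoint P N → P ∪ N ⊆ T → (P' ∪ N').Nonempty → P' ⊆ P → N' ⊆ N →
    lab P' N' ≠ - lab P N

lemma C_congr_aux {lab : Finset α → Finset α → ℤ} {T : Finset α} {L : Finset ℕ}
    (hl : Lab lab T L) (k : ℕ) : ∀ (P N : Finset α) (f g : List ℤ → ZMod 2),
    Disjoint P N → P ∪ N ⊆ T → (P ∪ N).card = k →
    (∀ l, l.length = k → Good L l → (∀ x ∈ l, ∃ P' N', P' ⊆ P ∧ N' ⊆ N ∧ (P' ∪ N').Nonempty ∧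
      x = lab P' N') → f l = g l) →
    C lab k P N f = C lab k P N g := by
  induction k with
  | zero =>
    intro P N f g _ _ _ h
    exact h [] rfl ⟨by simp, by simp⟩ (by simp)
  | succ k ih =>
    intro P N f g hd hT hc h
    rw [C, C]
    have hne : (P ∪ N).Nonempty := by rw [← Finset.card_pos]; omega
    refine Finset.sum_congr rfl fun i hi => ?_
    have he := Finset.erase_union_distrib P N i
    have hPs := Finset.erase_subset i P
    have hNs := Finset.erase_subset i N
    refine ih _ _ _ _ (hd.mono hPs hNs) ((Finset.union_subset_union hPs hNs).trans hT) ?_ ?_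
    · rw [← he, Finset.card_erase_of_mem hi, hc]; rfl
    · intro l hlen hgood hx
      apply h
      · simp [hlen]
      · have key : ∀ x ∈ l, x ≠ - lab P N := by
          intro x hxl
          obtain ⟨P', N', h1, h2, h3, rfl⟩ := hx x hxl
          exact hl.comp P N P' N' hd hT h3 (h1.trans hPs) (h2.trans hNs)
        have h0 := hl.ne0 P N hd hT hne
        refine ⟨?_, ?_⟩
        · intro x hxl
          rcases List.mem_cons.1 hxl with rfl | hxl
          · exact ⟨h0, hl.mem P N hd hT hne⟩
          · exact hgood.1 x hxl
        · intro x hxl y hyl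
          rcases List.mem_cons.1 hxl with rfl | hxl <;> rcases List.mem_cons.1 hyl with rfl | hyl
          · omega
          · have := key y hyl; omega
          · exact key x hxl
          · exact hgood.2 x hxl y hyl
      · intro x hxl
        rcases List.mem_cons.1 hxl with rfl | hxl
        · exact ⟨P, N, subset_rfl, subset_rfl, hne, rfl⟩
        · obtain ⟨P', N', h1, h2, h3, rfl⟩ := hx x hxl
          exact ⟨P', N', h1.trans hPs, h2.trans hNs, h3, rfl⟩

lemma C_congr {lab : Finset α → Finset α → ℤ} {T : Finset α} {L : Finset ℕ}
    (hl : Lab lab T L) {k : ℕ} {P N : Finset α} {f g : List ℤ → ZMod 2}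
    (hd : Disjoint P N) (hT : P ∪ N ⊆ T) (hc : (P ∪ N).card = k)
    (h : ∀ l, l.length = k → Good L l → f l = g l) :
    C lab k P N f = C lab k P N g :=
  C_congr_aux hl k P N f g hd hT hc fun l h1 h2 _ => h l h1 h2

lemma C_anti {lab : Finset α → Finset α → ℤ} {T : Finset α} {L : Finset ℕ}
    (hl : Lab lab T L) (k : ℕ) : ∀ (P N : Finset α) (f : List ℤ → ZMod 2),
    Disjoint P N → P ∪ N ⊆ T → (P ∪ N).card = k →
    C lab k N P f = C lab k P N (fun l => f (l.map (fun x => -x))) := by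
  induction k with
  | zero => intro P N f _ _ _; simp [C]
  | succ k ih =>
    intro P N f hd hT hc
    have hne : (P ∪ N).Nonempty := by rw [← Finset.card_pos]; omega
    rw [C, C, Finset.union_comm N P]
    refine Finset.sum_congr rfl fun i hi => ?_
    have he := Finset.erase_union_distrib P N i
    have hPs := Finset.erase_subset i P
    have hNs := Finset.erase_subset i N
    rw [ih _ _ _ (hd.mono hPs hNs) ((Finset.union_subset_union hPs hNs).trans hT)
      (by rw [← he, Finset.card_erase_of_mem hi, hc]; rfl)]
    simp only [List.map_cons, hl.anti P N hd hT hne]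

/-! alternating lists -/

def alt : Bool → List ℤ → ZMod 2
  | _, [] => 1
  | b, v :: l => if decide (0 < v) = b then alt (!b) l else 0

lemma dl_alt (l : List ℤ) : ∀ b, dl l (alt b) = alt b l + alt (!b) l := by
  induction l with
  | nil => intro b; simp only [dl, alt]; decide
  | cons v l ih =>
    intro b
    have hz : ∀ l : List ℤ, dl l (fun _ => 0) = 0 := by
      intro l; induction l with
      | nil => rfl
      | cons v l ih => simp [dl, ih]
    by_cases h : decide (0 < v) = b
    · have : (fun t => alt b (v :: t)) = alt (!b) := by funext t; simp [alt, h]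
      rw [dl, this, ih]
      have h' : ¬ (decide (0 < v) = !b) := by rw [h]; cases b <;> simp
      simp only [alt, if_pos h, if_neg h', Bool.not_not]
      have := CharTwo.add_self_eq_zero (alt b l)
      linear_combination this
    · have : (fun t => alt b (v :: t)) = fun _ => 0 := by funext t; simp [alt, h]
      rw [dl, this, hz]
      have h' : (decide (0 < v) = !b) := by revert h; cases b <;> simp
      simp only [alt, if_pos h', if_neg h, Bool.not_not]
      ring

lemma dl_perm {l l' : List ℤ} (h : l.Perm l') : ∀ f : List ℤ → ZMod 2,
    (∀ a b, List.Perm a b → f a = f b) → dl l f = dl l' f := by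
  induction h with
  | nil => intros; rfl
  | cons x h ih =>
    intro f hf
    rw [dl, dl, hf _ _ h, ih]
    intro a b hab; exact hf _ _ (hab.cons x)
  | swap x y l =>
    intro f hf
    simp only [dl]
    have : (fun t => f (x :: y :: t)) = (fun t => f (y :: x :: t)) := by
      funext t; exact hf _ _ (List.Perm.swap _ _ _)
    rw [this]; ring
  | trans _ _ h1 h2 => intro f hf; rw [h1 f hf, h2 f hf]

def r (a b : ℤ) : Prop := a.natAbs < b.natAbs ∨ (a.natAbs = b.natAbs ∧ a ≤ b)

instance : DecidableRel r := fun a b => by unfold r; infer_instance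
instance : Std.Total r := ⟨fun a b => by unfold r; omega⟩
instance : IsTrans ℤ r := ⟨fun a b c => by unfold r; omega⟩
instance : Std.Antisymm r := ⟨fun a b => by unfold r; omega⟩

def srt (l : List ℤ) : List ℤ := l.insertionSort r

lemma srt_perm (l : List ℤ) : (srt l).Perm l := List.perm_insertionSort r l
lemma srt_sorted (l : List ℤ) : (srt l).Pairwise r := List.pairwise_insertionSort r l
lemma srt_eq {l l' : List ℤ} (h : l'.Perm l) (hs : l'.Pairwise r) : srt l = l' :=
  List.Perm.eq_of_pairwise' (srt_sorted l) hs ((srt_perm l).trans h.symm)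

def A (b : Bool) (l : List ℤ) : ZMod 2 := alt b (srt l)

lemma A_perm (b : Bool) (l l' : List ℤ) (h : l.Perm l') : A b l = A b l' := by
  unfold A; rw [srt_eq ((srt_perm l').trans h.symm) (srt_sorted l')]

lemma dl_congr_sub (l : List ℤ) : ∀ (f g : List ℤ → ZMod 2),
    (∀ t, t.Sublist l → f t = g t) → dl l f = dl l g := by
  induction l with
  | nil => intros; rfl
  | cons v l ih =>
    intro f g h
    rw [dl, dl, h l (List.sublist_cons_self _ _), ih]
    intro t ht; exact h _ (ht.cons_cons v)

lemma dl_A (b : Bool) (l : List ℤ) : dl l (A b) = A b l + A (!b) l := by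
  rw [dl_perm (srt_perm l).symm _ (A_perm b), dl_congr_sub (srt l) (A b) (alt b), dl_alt]
  · rfl
  · intro t ht
    unfold A
    rw [srt_eq (List.Perm.refl t) ((srt_sorted l).sublist ht)]

lemma alt_neg (l : List ℤ) : ∀ b, (∀ x ∈ l, x ≠ 0) →
    alt b (l.map (fun x => -x)) = alt (!b) l := by
  induction l with
  | nil => intros; rfl
  | cons v l ih =>
    intro b h
    have h0 := h v (by simp)
    have : (decide (0 < -v) = b) ↔ (decide (0 < v) = !b) := by
      rcases lt_or_gt_of_ne h0 with h1 | h1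
      · have h2 : ¬ (0 < v) := by omega
        have h3 : v < 0 := h1
        cases b <;> simp [h2, h3]
      · have h2 : ¬ (v < 0) := by omega
        have h3 : 0 < v := h1
        cases b <;> simp [h2, h3]
    simp only [List.map_cons, alt, this]
    rw [ih _ (fun x hx => h x (by simp [hx]))]

lemma A_neg {L : Finset ℕ} {l : List ℤ} (h : Good L l) (b : Bool) :
    A b (l.map (fun x => -x)) = A (!b) l := by
  unfold A
  rw [srt_eq (l' := (srt l).map (fun x => -x)) ((srt_perm l).map _), alt_neg]
  · intro x hx; exact (h.1 x ((srt_perm l).mem_iff.1 hx)).1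
  · rw [List.pairwise_map]
    refine (srt_sorted l).imp_of_mem ?_
    intro a c ha hc hr
    have := h.2 a ((srt_perm l).mem_iff.1 ha) c ((srt_perm l).mem_iff.1 hc)
    unfold r at *
    omega

lemma alt_lt {l : List ℤ} : ∀ b, (∀ x ∈ l, ∀ y ∈ l, x ≠ -y) → l.Pairwise r → alt b l ≠ 0 →
    (l.map Int.natAbs).Pairwise (· < ·) := by
  induction l with
  | nil => intros; simp
  | cons v l ih =>
    intro b h1 h2 h3
    simp only [alt] at h3
    split_ifs at h3 with hv
    · have hl := ih (!b) (fun x hx y hy => h1 x (by simp [hx]) y (by simp [hy]))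
        (List.pairwise_cons.1 h2).2 h3
      rw [List.map_cons, List.pairwise_cons]
      refine ⟨?_, hl⟩
      cases l with
      | nil => simp
      | cons w l =>
        have hvw : v.natAbs < w.natAbs := by
          have ha := (List.pairwise_cons.1 h2).1 w (by simp)
          have hb := h1 v (by simp) w (by simp)
          have hc : v ≠ w := by
            rintro rfl
            simp only [alt] at h3
            split_ifs at h3 with h4
            · rw [hv] at h4; cases b <;> simp at h4
            · exact h3 rfl
          unfold r at ha
          omega
        rw [List.map_cons, List.pairwise_cons] at hl
        intro x hx
        rw [List.map_cons, List.mem_cons] at hx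
        rcases hx with rfl | hx
        · exact hvw
        · exact hvw.trans (hl.1 x hx)
    · exact absurd rfl h3

lemma A_zero {L : Finset ℕ} {l : List ℤ} (h : Good L l) (hc : L.card < l.length) (b : Bool) :
    A b l = 0 := by
  by_contra hne
  have hm : ∀ x, x ∈ srt l ↔ x ∈ l := fun x => (srt_perm l).mem_iff
  have := alt_lt b (fun x hx y hy => h.2 x ((hm x).1 hx) y ((hm y).1 hy)) (srt_sorted l) hne
  have hnd : ((srt l).map Int.natAbs).Nodup := this.imp (fun h => ne_of_lt h)
  have hsub : ((srt l).map Int.natAbs).toFinset ⊆ L := by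
    intro x hx
    rw [List.mem_toFinset, List.mem_map] at hx
    obtain ⟨y, hy, rfl⟩ := hx
    exact (h.1 y ((hm y).1 hy)).2
  have := Finset.card_le_card hsub
  rw [List.toFinset_card_of_nodup hnd, List.length_map, (srt_perm l).length_eq] at this
  omega

/-- Boundary of the hemisphere. -/
lemma hemi (lab : Finset α → Finset α → ℤ) (a : α) (T : Finset α) (ha : a ∉ T)
    (f : List ℤ → ZMod 2) :
    ∑ P ∈ T.powerset, C lab (T.card + 1) (insert a P) (T \ P) (fun l => dl l f)
      = ∑ P ∈ T.powerset, C lab T.card P (T \ P) f := by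
  have h1 : ∀ P ∈ T.powerset, C lab (T.card + 1) (insert a P) (T \ P) (fun l => dl l f)
      = C lab T.card P (T \ P) f +
        ∑ i ∈ T, C lab T.card ((insert a P).erase i) ((T \ P).erase i) f := by
    intro P hP
    rw [Finset.mem_powerset] at hP
    have hu : insert a P ∪ (T \ P) = insert a T := by
      rw [Finset.insert_union, Finset.union_sdiff_of_subset hP]
    rw [C_dl _ _ _ _ _ (by rw [hu, Finset.card_insert_of_notMem ha]), hu,
      Finset.sum_insert ha, Finset.erase_insert (fun h => ha (hP h)),
      Finset.erase_eq_of_notMem (s := T \ P) (fun h => ha (Finset.sdiff_subset h))]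
  rw [Finset.sum_congr rfl h1, Finset.sum_add_distrib, Finset.sum_comm]
  rw [Finset.sum_eq_zero (s := T), add_zero]
  intro i hi
  obtain ⟨T', hT', rfl⟩ : ∃ T', i ∉ T' ∧ T = insert i T' :=
    ⟨T.erase i, Finset.notMem_erase i T, (Finset.insert_erase hi).symm⟩
  generalize (insert i T').card = q
  rw [Finset.sum_powerset_insert hT', ← Finset.sum_add_distrib]
  refine Finset.sum_eq_zero fun P hP => ?_
  rw [Finset.mem_powerset] at hP
  have e1 : (insert a (insert i P)).erase i = (insert a P).erase i := by
    ext x; simp only [Finset.mem_erase, Finset.mem_insert]; tauto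
  have e2 : (insert i T' \ insert i P).erase i = (insert i T' \ P).erase i := by
    ext x; simp only [Finset.mem_erase, Finset.mem_insert, Finset.mem_sdiff]; tauto
  rw [e1, e2]
  exact CharTwo.add_self_eq_zero _

lemma hemi_one {lab : Finset α → Finset α → ℤ} {T₀ : Finset α} {L : Finset ℕ}
    (hl : Lab lab T₀ L) (T : Finset α) : ∀ a, a ∉ T → insert a T ⊆ T₀ →
    ∑ P ∈ T.powerset, C lab (T.card + 1) (insert a P) (T \ P)
      (fun l => A true l + A false l) = 1 := by
  induction T using Finset.induction_on with
  | empty =>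
    intro a ha hs
    have := hemi lab a ∅ ha (A true)
    simp only [dl_A, Bool.not_true] at this
    rw [this]
    simp [C, A, alt, srt]
  | insert b T hb ih =>
    intro a ha hs
    have := hemi lab a _ ha (A true)
    simp only [dl_A, Bool.not_true] at this
    rw [this]
    have hs' : insert b T ⊆ T₀ := (Finset.subset_insert _ _).trans hs
    rw [← ih b hb hs', Finset.sum_powerset_insert hb, Finset.card_insert_of_notMem hb]
    simp only [C_add, Finset.sum_add_distrib]
    rw [add_comm]
    congr 1
    · refine Finset.sum_congr rfl fun P hP => ?_
      have e1 : insert b T \ insert b P = T \ P := by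
        ext x; simp only [Finset.mem_insert, Finset.mem_sdiff]
        by_cases hx : x = b
        · subst hx; simp [hb]
        · simp [hx]
      rw [e1]
    · refine Finset.sum_nbij' (fun P => T \ P) (fun P => T \ P) ?_ ?_ ?_ ?_ ?_
      · intro P _; simp
      · intro P _; simp
      · intro P hP; simpa using hP
      · intro P hP; simpa using hP
      · intro P hP
        rw [Finset.mem_powerset] at hP
        have hbP : b ∉ P := fun h => hb (hP h)
        have e2 : insert b T \ P = insert b (T \ P) := by
          rw [Finset.insert_sdiff_of_notMem _ hbP]
        have e4 : insert b (T \ P) ∪ P = insert b T := by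
          rw [Finset.insert_union, Finset.sdiff_union_of_subset hP]
        have hd : Disjoint (insert b (T \ P)) P := by
          rw [Finset.disjoint_insert_left]
          exact ⟨hbP, Finset.sdiff_disjoint⟩
        have hcd : (insert b (T \ P) ∪ P).card = T.card + 1 := by
          rw [e4, Finset.card_insert_of_notMem hb]
        rw [e2, Finset.sdiff_sdiff_eq_self hP, C_anti hl _ _ _ _ hd (by rw [e4]; exact hs') hcd]
        exact C_congr hl hd (by rw [e4]; exact hs') hcd fun l _ hg => A_neg hg true

theorem tucker {lab : Finset α → Finset α → ℤ} {T : Finset α} {L : Finset ℕ}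
    (hl : Lab lab T L) (hne : T.Nonempty) (hc : L.card < T.card) : False := by
  obtain ⟨a, ha⟩ := hne
  have h1 := hemi_one hl (T.erase a) a (Finset.notMem_erase a T) (by rw [Finset.insert_erase ha])
  have h2 : ∀ P ∈ (T.erase a).powerset, C lab ((T.erase a).card + 1) (insert a P) (T.erase a \ P)
      (fun l => A true l + A false l) = 0 := by
    intro P hP
    rw [Finset.mem_powerset] at hP
    have hu : insert a P ∪ (T.erase a \ P) = T := by
      rw [Finset.insert_union, Finset.union_sdiff_of_subset hP, Finset.insert_erase ha]
    have hd : Disjoint (insert a P) (T.erase a \ P) := by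
      rw [Finset.disjoint_insert_left]
      exact ⟨by simp, Finset.disjoint_sdiff⟩
    have hcT := Finset.card_erase_add_one ha
    rw [C_congr hl (g := fun _ => 0) hd (by rw [hu]) (by rw [hu, hcT])]
    · have : ∀ k (P N : Finset α), C lab k P N (fun _ => 0) = 0 := by
        intro k
        induction k with
        | zero => intros; rfl
        | succ k ih => intro P N; simp [C, ih]
      exact this _ _ _
    · intro l h1 h2
      rw [A_zero h2 (by omega), A_zero h2 (by omega), add_zero]
  rw [Finset.sum_eq_zero h2] at h1
  exact absurd h1 (by decide)


/-! Alternating subsequences. -/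

/-- There is an alternating sequence of length `j` starting with sign `b`, from `lo` on. -/
def E {n : ℕ} (P N : Finset (Fin n)) : ℕ → Bool → ℕ → Prop
  | 0, _, _ => True
  | j+1, b, lo => ∃ x ∈ (if b then P else N), lo ≤ x.val ∧ E P N j (!b) (x.val + 1)

lemma E_mono {n : ℕ} {P N P' N' : Finset (Fin n)} (hP : P ⊆ P') (hN : N ⊆ N') (j : ℕ) :
    ∀ b lo, E P N j b lo → E P' N' j b lo := by
  induction j with
  | zero => intros; trivial
  | succ j ih =>
    rintro b lo ⟨x, hx, h1, h2⟩
    refine ⟨x, ?_, h1, ih _ _ h2⟩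
    cases b
    · exact hN hx
    · exact hP hx

lemma E_lo {n : ℕ} {P N : Finset (Fin n)} {j : ℕ} {b : Bool} {lo lo' : ℕ} (h : lo' ≤ lo)
    (hE : E P N j b lo) : E P N j b lo' := by
  cases j with
  | zero => trivial
  | succ j => obtain ⟨x, hx, h1, h2⟩ := hE; exact ⟨x, hx, h.trans h1, h2⟩

lemma E_swap {n : ℕ} {P N : Finset (Fin n)} (j : ℕ) :
    ∀ b lo, E P N j b lo ↔ E N P j (!b) lo := by
  induction j with
  | zero => intros; exact Iff.rfl
  | succ j ih =>
    intro b lo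
    simp only [E, ih]
    cases b <;> simp

lemma E_ext {n : ℕ} {P N : Finset (Fin n)} (hd : Disjoint P N) {j : ℕ}
    (h1 : E P N (j+1) true 0) (h2 : E P N (j+1) false 0) :
    E P N (j+2) true 0 ∨ E P N (j+2) false 0 := by
  obtain ⟨x, hx, _, hx2⟩ := h1
  obtain ⟨y, hy, _, hy2⟩ := h2
  simp only [if_true] at hx
  have hy : y ∈ N := by simpa using hy
  have hne : x.val ≠ y.val := fun e => by
    have : x = y := Fin.ext e
    subst this
    exact Finset.disjoint_left.1 hd hx hy
  rcases lt_or_gt_of_ne hne with h | h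
  · left
    exact ⟨x, by simpa using hx, Nat.zero_le _, y, by simpa using hy, h, hy2⟩
  · right
    exact ⟨y, by simpa using hy, Nat.zero_le _, x, by simpa using hx, h, hx2⟩

lemma E_stable {n : ℕ} {P N : Finset (Fin n)} (k : ℕ) : ∀ b lo, E P N (2*k) b lo →
    ∃ S : Finset (Fin n), S ⊆ (if b then P else N) ∧ S.card = k ∧
      (∀ x ∈ S, lo ≤ x.val ∧ x.val + 1 < n) ∧ (∀ x ∈ S, ∀ y ∈ S, x.val + 1 ≠ y.val) := by
  induction k with
  | zero => intro b lo _; exact ⟨∅, by simp⟩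
  | succ k ih =>
    rintro b lo ⟨x, hx, hlo, y, hy, hxy, h⟩
    obtain ⟨S, h1, h2, h3, h4⟩ := ih _ _ h
    rw [Bool.not_not] at h1
    have hxS : x ∉ S := fun hh => by have := (h3 x hh).1; omega
    refine ⟨insert x S, Finset.insert_subset hx h1, by rw [Finset.card_insert_of_notMem hxS, h2],
      ?_, ?_⟩
    · intro z hz
      rcases Finset.mem_insert.1 hz with rfl | hz
      · have := y.isLt; omega
      · have := h3 z hz; omega
    · intro z hz w hw
      rcases Finset.mem_insert.1 hz with hz1 | hz1 <;>
        rcases Finset.mem_insert.1 hw with hw1 | hw1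
      · subst hz1 hw1; omega
      · subst hz1; have := h3 w hw1; omega
      · subst hw1; have := h3 z hz1; omega
      · exact h4 z hz1 w hw1

open Classical in
noncomputable def al {n : ℕ} (K : ℕ) (b : Bool) (P N : Finset (Fin n)) : ℕ :=
  Nat.findGreatest (fun j => E P N j b 0) K

lemma al_spec {n : ℕ} (K : ℕ) (b : Bool) (P N : Finset (Fin n)) : E P N (al K b P N) b 0 := by
  classical
  unfold al
  exact Nat.findGreatest_spec (P := fun j => E P N j b 0) (Nat.zero_le K) trivial

lemma le_al {n : ℕ} {K : ℕ} {b : Bool} {P N : Finset (Fin n)} {j : ℕ} (hj : j ≤ K)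
    (h : E P N j b 0) : j ≤ al K b P N := by
  classical
  unfold al
  exact Nat.le_findGreatest hj h

lemma al_le {n : ℕ} (K : ℕ) (b : Bool) (P N : Finset (Fin n)) : al K b P N ≤ K := by
  classical
  unfold al
  exact Nat.findGreatest_le K

lemma al_mono {n : ℕ} (K : ℕ) (b : Bool) {P N P' N' : Finset (Fin n)} (hP : P ⊆ P')
    (hN : N ⊆ N') : al K b P N ≤ al K b P' N' :=
  le_al (al_le _ _ _ _) (E_mono hP hN _ _ _ (al_spec _ _ _ _))

lemma al_swap {n : ℕ} (K : ℕ) (b : Bool) (P N : Finset (Fin n)) :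
    al K b N P = al K (!b) P N := by
  apply le_antisymm
  · exact le_al (al_le _ _ _ _) ((E_swap _ _ _).1 (al_spec _ _ _ _))
  · refine le_al (al_le _ _ _ _) ((E_swap _ _ _).2 (al_spec _ _ _ _))

lemma al_ne {n : ℕ} {K : ℕ} {P N : Finset (Fin n)} (hd : Disjoint P N) (hne : (P ∪ N).Nonempty)
    (h1 : al K true P N < K) (h2 : al K false P N < K) : al K true P N ≠ al K false P N := by
  intro he
  have s1 := al_spec K true P N
  have s2 := al_spec K false P N
  rw [← he] at s2
  cases hj : al K true P N with
  | zero =>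
    obtain ⟨x, hx⟩ := hne
    rcases Finset.mem_union.1 hx with hx | hx
    · have : 1 ≤ al K true P N :=
        le_al (by omega) ⟨x, by simpa using hx, Nat.zero_le _, trivial⟩
      omega
    · have : 1 ≤ al K false P N :=
        le_al (by omega) ⟨x, by simpa using hx, Nat.zero_le _, trivial⟩
      omega
  | succ j =>
    rw [hj] at s1 s2
    rcases E_ext hd s1 s2 with h | h
    · have := le_al (K := K) (by omega) h; omega
    · have := le_al (K := K) (by omega) h; omega

lemma indep {n : ℕ} {S : Finset (Fin n)} (h3 : ∀ x ∈ S, x.val + 1 < n)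
    (h4 : ∀ x ∈ S, ∀ y ∈ S, x.val + 1 ≠ y.val) :
    ∀ v ∈ S, ∀ w ∈ S, ¬ (SimpleGraph.cycleGraph n).Adj v w := by
  have key : ∀ v ∈ S, ∀ w ∈ S, (v - w).val ≠ 1 := by
    intro v hv w hw h
    have a := h3 v hv
    have b := h3 w hw
    have c := h4 w hw v hv
    rcases le_or_gt w v with hle | hlt
    · rw [Fin.sub_val_of_le hle] at h
      have : w.val ≤ v.val := hle
      omega
    · rw [Fin.val_sub] at h
      have : v.val < w.val := hlt
      rw [Nat.mod_eq_of_lt (by omega)] at h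
      omega
  intro v hv w hw hadj
  rw [SimpleGraph.cycleGraph_adj'] at hadj
  rcases hadj with h | h
  · exact key v hv w hw h
  · exact key w hw v hv h

/-- indices of parts in which one of the two sides has more than `r i` elements -/
def maj {n m : ℕ} (A : Fin m → Finset (Fin n)) (q : Fin m → ℕ) (P N : Finset (Fin n)) :
    Finset (Fin m) :=
  Finset.univ.filter fun i => q i < (P ∩ A i).card ∨ q i < (N ∩ A i).card

lemma maj_swap {n m : ℕ} (A : Fin m → Finset (Fin n)) (q : Fin m → ℕ) (P N : Finset (Fin n)) :
    maj A q N P = maj A q P N := by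
  ext i; simp [maj, or_comm]

noncomputable def lb {n m : ℕ} (A : Fin m → Finset (Fin n)) (q : Fin m → ℕ)
    (g : Finset (Fin m) → Fin m) (K : ℕ) (P N : Finset (Fin n)) : ℤ :=
  if al K true P N < K ∧ al K false P N < K then
    if al K false P N < al K true P N then (al K true P N : ℤ) else -(al K false P N : ℤ)
  else
    if q (g (maj A q P N)) < (P ∩ A (g (maj A q P N))).card then
      ((K + (g (maj A q P N)).val : ℕ) : ℤ) else -((K + (g (maj A q P N)).val : ℕ) : ℤ)

lemma main {n m : ℕ} (A : Fin m → Finset (Fin n)) (q : Fin m → ℕ) (U : Finset (Fin n))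
    (I : Finset (Fin m)) (hI : ∀ i, (A i).Nonempty → i ∈ I)
    (hdisj : ∀ i j, i ≠ j → Disjoint (A i) (A j))
    (hcover : Finset.univ.biUnion A = Finset.univ)
    (hU : ∀ i, (U ∩ A i).card ≤ 2 * q i + 1)
    (hk : 0 < ∑ i, q i)
    (hUc : U.card = 2 * (∑ i, q i) + I.card) :
    ∃ S : Finset (Fin n),
      (∀ v ∈ S, ∀ w ∈ S, ¬ (SimpleGraph.cycleGraph n).Adj v w) ∧
      ∀ i : Fin m, q i ≤ (S ∩ A i).card := by
  by_contra hno
  push Not at hno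
  set k := ∑ i, q i with hkdef
  have hm : Nonempty (Fin m) := by
    by_contra h
    rw [not_nonempty_iff] at h
    simp [hkdef] at hk
  obtain ⟨g, hg⟩ : ∃ g : Finset (Fin m) → Fin m, ∀ M, M.Nonempty → g M ∈ M := by
    classical
    refine ⟨fun M => if h : M.Nonempty then h.choose else hm.some, fun M h => ?_⟩
    simp only [dif_pos h]
    exact h.choose_spec
  -- a stable set of size `k` gives a part with too many elements
  have hS : ∀ S : Finset (Fin n), S.card = k →
      (∀ v ∈ S, ∀ w ∈ S, ¬ (SimpleGraph.cycleGraph n).Adj v w) → ∃ i, q i < (S ∩ A i).card := by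
    intro S hc hst
    by_contra hle
    push Not at hle
    obtain ⟨i, hi⟩ := hno S hst
    have hsum : S.card = ∑ i, (S ∩ A i).card := by
      rw [← Finset.card_biUnion, ← Finset.inter_biUnion, hcover, Finset.inter_univ]
      intro i _ j _ hij
      exact (hdisj i j hij).mono Finset.inter_subset_right Finset.inter_subset_right
    have : ∑ i, (S ∩ A i).card < ∑ i, q i :=
      Finset.sum_lt_sum (fun i _ => hle i) ⟨i, Finset.mem_univ i, hi⟩
    omega
  have hbig : ∀ P N : Finset (Fin n),
      ¬ (al (2*k) true P N < 2*k ∧ al (2*k) false P N < 2*k) → (maj A q P N).Nonempty := by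
    intro P N h
    have : ∃ b, al (2*k) b P N = 2*k := by
      by_contra hb
      push Not at hb
      exact h ⟨lt_of_le_of_ne (al_le _ _ _ _) (hb true), lt_of_le_of_ne (al_le _ _ _ _) (hb false)⟩
    obtain ⟨b, hb⟩ := this
    have sp := al_spec (2*k) b P N
    rw [hb] at sp
    obtain ⟨S, h1, h2, h3, h4⟩ := E_stable k b 0 sp
    obtain ⟨i, hi⟩ := hS S h2 (indep (fun x hx => (h3 x hx).2) h4)
    refine ⟨i, ?_⟩
    rw [maj, Finset.mem_filter]
    refine ⟨Finset.mem_univ i, ?_⟩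
    have hle := Finset.card_le_card (Finset.inter_subset_inter_right h1 (u := A i))
    cases b
    · right; exact lt_of_lt_of_le hi (by simpa using hle)
    · left; exact lt_of_lt_of_le hi (by simpa using hle)
  have hnb : ∀ P N : Finset (Fin n), Disjoint P N → P ∪ N ⊆ U → ∀ i,
      q i < (P ∩ A i).card → q i < (N ∩ A i).card → False := by
    intro P N hd hu i h1 h2
    have hdd : Disjoint (P ∩ A i) (N ∩ A i) :=
      hd.mono Finset.inter_subset_left Finset.inter_subset_left
    have hle : (P ∩ A i) ∪ (N ∩ A i) ⊆ U ∩ A i := by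
      rw [← Finset.union_inter_distrib_right]
      exact Finset.inter_subset_inter_right hu
    have := Finset.card_le_card hle
    rw [Finset.card_union_of_disjoint hdd] at this
    have := hU i
    omega
  have hgm : ∀ P N : Finset (Fin n),
      ¬ (al (2*k) true P N < 2*k ∧ al (2*k) false P N < 2*k) →
      q (g (maj A q P N)) < (P ∩ A (g (maj A q P N))).card ∨
      q (g (maj A q P N)) < (N ∩ A (g (maj A q P N))).card := by
    intro P N h
    have := hg _ (hbig P N h)
    simpa [maj] using this
  have hlab : Lab (lb A q g (2*k)) U (Finset.Ico 1 (2*k) ∪ I.image (fun i => 2*k + i.val)) := by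
    refine ⟨?_, ?_, ?_, ?_⟩
    · intro P N hd hu hne
      unfold lb
      split_ifs with h1 h2 h3
      · omega
      · have := al_ne hd hne h1.1 h1.2; omega
      · omega
      · omega
    · intro P N hd hu hne
      unfold lb
      rw [Finset.mem_union, Finset.mem_Ico, Finset.mem_image]
      split_ifs with h1 h2 h3
      · left; omega
      · have := al_ne hd hne h1.1 h1.2; left; omega
      · right
        refine ⟨g (maj A q P N), hI _ ?_, by omega⟩
        have : 0 < (P ∩ A (g (maj A q P N))).card := by omega
        exact (Finset.card_pos.1 this).mono Finset.inter_subset_right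
      · right
        refine ⟨g (maj A q P N), hI _ ?_, by omega⟩
        have h4 := (hgm P N h1).resolve_left h3
        have : 0 < (N ∩ A (g (maj A q P N))).card := by omega
        exact (Finset.card_pos.1 this).mono Finset.inter_subset_right
    · intro P N hd hu hne
      unfold lb
      rw [maj_swap, al_swap _ true P N, al_swap _ false P N, Bool.not_true, Bool.not_false]
      by_cases h1 : al (2*k) true P N < 2*k ∧ al (2*k) false P N < 2*k
      · rw [if_pos h1.symm, if_pos h1]
        have := al_ne hd hne h1.1 h1.2
        split_ifs <;> omega
      · rw [if_neg (fun h => h1 h.symm), if_neg h1]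
        have h2 := hgm P N h1
        have h3 := hnb P N hd hu (g (maj A q P N))
        split_ifs with h4 h5 h5
        · exact (h3 h5 h4).elim
        · omega
        · omega
        · exact (h2.elim h5 h4).elim
    · intro P N P' N' hd hu hne hP hN
      have hne2 : (P ∪ N).Nonempty := hne.mono (Finset.union_subset_union hP hN)
      have hd' := hd.mono hP hN
      have m1 := al_mono (2*k) true hP hN
      have m2 := al_mono (2*k) false hP hN
      by_cases h1 : al (2*k) true P N < 2*k ∧ al (2*k) false P N < 2*k
      · have h1' : al (2*k) true P' N' < 2*k ∧ al (2*k) false P' N' < 2*k := by omega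
        have a1 := al_ne hd hne2 h1.1 h1.2
        have a2 := al_ne hd' hne h1'.1 h1'.2
        unfold lb
        rw [if_pos h1, if_pos h1']
        split_ifs <;> omega
      · by_cases h1' : al (2*k) true P' N' < 2*k ∧ al (2*k) false P' N' < 2*k
        · unfold lb
          rw [if_neg h1, if_pos h1']
          split_ifs <;> omega
        · have b1 := hgm P N h1
          have b2 := hgm P' N' h1'
          unfold lb
          rw [if_neg h1, if_neg h1']
          generalize g (maj A q P N) = i at *
          generalize g (maj A q P' N') = j at *
          have c1 := Finset.card_le_card (Finset.inter_subset_inter_right hP (u := A j))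
          have c2 := Finset.card_le_card (Finset.inter_subset_inter_right hN (u := A j))
          have c3 := hnb P N hd hu j
          intro heq
          have hij : i = j := by
            apply Fin.ext
            split_ifs at heq <;> omega
          subst hij
          split_ifs at heq with h4 h5 h5
          · omega
          · exact c3 (by omega) (b1.resolve_left h5)
          · exact c3 h5 (lt_of_lt_of_le (b2.resolve_left h4) c2)
          · omega
  refine tucker hlab (Finset.card_pos.1 (by omega)) ?_
  have d1 := Finset.card_union_le (Finset.Ico 1 (2*k)) (I.image (fun i => 2*k + i.val))
  have d2 : (I.image (fun i => 2*k + i.val)).card ≤ I.card := Finset.card_image_le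
  rw [Nat.card_Ico] at d1
  omega

end Fair

/-- Almost-½-fair representation in cycles: for every partition of the vertex set of the
cycle `Cₙ` there is an independent set meeting each part `A i` in at least `|A i|/2 - 1`
elements. -/
theorem stmt15 (n : ℕ) (m : ℕ) (A : Fin m → Finset (Fin n))
    (hdisj : ∀ i j, i ≠ j → Disjoint (A i) (A j))
    (hcover : Finset.univ.biUnion A = Finset.univ) :
    ∃ S : Finset (Fin n),
      (∀ v ∈ S, ∀ w ∈ S, ¬ (SimpleGraph.cycleGraph n).Adj v w) ∧
      ∀ i : Fin m, ((A i).card : ℝ) / 2 - 1 ≤ ((S ∩ A i).card : ℝ) := by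
  suffices h : ∃ S : Finset (Fin n),
      (∀ v ∈ S, ∀ w ∈ S, ¬ (SimpleGraph.cycleGraph n).Adj v w) ∧
      ∀ i : Fin m, ((A i).card - 1) / 2 ≤ (S ∩ A i).card by
    obtain ⟨S, h1, h2⟩ := h
    refine ⟨S, h1, fun i => ?_⟩
    have h3 : (A i).card ≤ 2 * (S ∩ A i).card + 2 := by have := h2 i; omega
    have h4 : ((A i).card : ℝ) ≤ 2 * ((S ∩ A i).card : ℝ) + 2 := by exact_mod_cast h3
    linarith
  rcases Nat.eq_zero_or_pos (∑ i, ((A i).card - 1) / 2) with hk | hk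
  · refine ⟨∅, by simp, fun i => ?_⟩
    rw [Finset.sum_eq_zero_iff] at hk
    rw [hk i (Finset.mem_univ i)]
    exact Nat.zero_le _
  · have hB : ∀ i, ∃ B, B ⊆ A i ∧
        B.card = if (A i).Nonempty then 2 * (((A i).card - 1) / 2) + 1 else 0 := by
      intro i
      apply Finset.exists_subset_card_eq
      split_ifs with h
      · have := Finset.card_pos.2 h; omega
      · exact Nat.zero_le _
    choose B hB1 hB2 using hB
    refine Fair.main A (fun i => ((A i).card - 1) / 2) (Finset.univ.biUnion B)
      (Finset.univ.filter fun i => (A i).Nonempty) (by simp) hdisj hcover ?_ hk ?_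
    · intro i
      have : Finset.univ.biUnion B ∩ A i ⊆ B i := by
        intro x hx
        rw [Finset.mem_inter, Finset.mem_biUnion] at hx
        obtain ⟨⟨j, _, hj⟩, hi⟩ := hx
        by_cases hij : j = i
        · subst hij; exact hj
        · exact (Finset.disjoint_left.1 (hdisj j i hij) (hB1 j hj) hi).elim
      refine (Finset.card_le_card this).trans ?_
      rw [hB2]
      split_ifs <;> omega
    · rw [Finset.card_biUnion
        (fun i _ j _ hij => (hdisj i j hij).mono (hB1 i) (hB1 j)), Finset.card_filter,
        Finset.mul_sum, ← Finset.sum_add_distrib]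
      refine Finset.sum_congr rfl fun i _ => ?_
      rw [hB2]
      split_ifs with h
      · rfl
      · rw [Finset.not_nonempty_iff_eq_empty] at h
        simp [h]
end

section
/- If P is a path graph and (A₁, …, A_m) is a partition of its vertex set, then there exists an independent set S of P with |S ∩ A_i| ≥ |A_i|/2 − 1 for all i ≤ m. -/
open Finset

namespace FairPath

/-- Mod 2 coboundary on functions of lists: sum of `f` over all one-element deletions. -/
def bd {α : Type*} : List α → (List α → ZMod 2) → ZMod 2
  | [], _ => 0
  | x :: l, f => f l + bd l (fun l' => f (x :: l'))

/-- Indicator of alternating parity, starting with the sign `ε`. -/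
def g : Bool → List ℕ → ZMod 2
  | _, [] => 1
  | ε, a :: l => if decide (a % 2 = 1) = ε then g (!ε) l else 0

lemma zz (a : ZMod 2) : a + a = 0 := CharTwo.add_self_eq_zero a

lemma bd_zero {α : Type*} (l : List α) : bd l (fun _ => 0) = 0 := by
  induction l with
  | nil => rfl
  | cons a l ih => simp [bd, ih]

lemma bd_add {α : Type*} (l : List α) : ∀ (f f' : List α → ZMod 2),
    bd l (fun x => f x + f' x) = bd l f + bd l f' := by
  induction l with
  | nil => intros; simp [bd]
  | cons a l ih => intro f f'; simp only [bd, ih]; ring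

lemma g_bd (l : List ℕ) : ∀ ε, bd l (g ε) = g ε l + g (!ε) l := by
  induction l with
  | nil => intro ε; simp [bd, g, zz]
  | cons a l ih =>
    intro ε
    simp only [bd, g]
    by_cases h : decide (a % 2 = 1) = ε
    · have h2 : ¬ decide (a % 2 = 1) = !ε := by rw [h]; cases ε <;> simp
      simp only [h, if_true]
      rw [ih]
      have := zz (g ε l)
      simp
      rw [← add_assoc, add_comm (g ε l), add_assoc, this, add_zero]
    · have h2 : decide (a % 2 = 1) = !ε := by
        revert h; cases decide (a % 2 = 1) <;> cases ε <;> simp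
      simp [h2, bd_zero]

lemma bd_map {α β : Type*} (φ : α → β) (l : List α) : ∀ (f : List β → ZMod 2),
    bd (l.map φ) f = bd l (fun l' => f (l'.map φ)) := by
  induction l with
  | nil => intro f; rfl
  | cons a l ih => intro f; simp [bd, ih]

lemma bd_congr {α : Type*} (l : List α) : ∀ (f f' : List α → ZMod 2),
    (∀ l', l'.Sublist l → f l' = f' l') → bd l f = bd l f' := by
  induction l with
  | nil => intros; rfl
  | cons a l ih =>
    intro f f' h
    simp only [bd]
    rw [h l (List.sublist_cons_self a l), ih]
    intro l' hl'
    exact h _ (hl'.cons_cons a)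

lemma bd_perm {α : Type*} {l l' : List α} (h : l.Perm l') : ∀ (f : List α → ZMod 2),
    (∀ a b : List α, a.Perm b → f a = f b) → bd l f = bd l' f := by
  induction h with
  | nil => intros; rfl
  | cons x h ih =>
    intro f hf
    simp only [bd]
    rw [hf _ _ h, ih _ (fun a b hab => hf _ _ (hab.cons x))]
  | swap x y l =>
    intro f hf
    simp only [bd]
    have : (fun l' => f (y :: x :: l')) = (fun l' => f (x :: y :: l')) := by
      funext l'; exact hf _ _ (List.Perm.swap _ _ _)
    rw [this]; ring
  | trans h1 h2 ih1 ih2 => intro f hf; rw [ih1 f hf, ih2 f hf]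

/-- Sorted list of labels. -/
def srt (l : List ℕ) : List ℕ := l.insertionSort (· ≤ ·)

lemma srt_perm (l : List ℕ) : (srt l).Perm l := List.perm_insertionSort _ _

lemma srt_pw (l : List ℕ) : (srt l).Pairwise (· ≤ ·) := List.pairwise_insertionSort _ _

lemma srt_unique {l s : List ℕ} (h : s.Perm l) (hs : s.Pairwise (· ≤ ·)) : srt l = s :=
  List.Perm.eq_of_pairwise (fun _ _ _ _ h1 h2 => le_antisymm h1 h2) (srt_pw l) hs
    ((srt_perm l).trans h.symm)

/-- Indicator that the sorted labels alternate, starting with `ε`. -/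
def al (ε : Bool) (l : List ℕ) : ZMod 2 := g ε (srt l)

lemma al_perm (ε : Bool) (a b : List ℕ) (h : a.Perm b) : al ε a = al ε b := by
  unfold al
  rw [srt_unique ((srt_perm b).trans h.symm) (srt_pw b)]

lemma al_bd (ε : Bool) (l : List ℕ) : bd l (al ε) = al ε l + al (!ε) l := by
  rw [bd_perm (srt_perm l).symm _ (al_perm ε), bd_congr _ _ (g ε), g_bd]
  · rfl
  · intro l' hl'
    unfold al
    rw [srt_unique (List.Perm.refl l') ((srt_pw l).sublist hl')]

/-- The opposite label. -/
def ng (a : ℕ) : ℕ := a / 2 * 2 + (1 - a % 2)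

lemma g_ng (l : List ℕ) : ∀ ε, g ε (l.map ng) = g (!ε) l := by
  induction l with
  | nil => intro ε; rfl
  | cons a l ih =>
    intro ε
    simp only [List.map_cons, g, ih]
    have h : decide (ng a % 2 = 1) = !decide (a % 2 = 1) := by
      unfold ng
      by_cases h : a % 2 = 1
      · have : ¬ (a / 2 * 2 + (1 - a % 2)) % 2 = 1 := by omega
        simp [h]
      · have : (a / 2 * 2 + (1 - a % 2)) % 2 = 1 := by omega
        simp [h, this]
    rw [h]
    cases decide (a % 2 = 1) <;> cases ε <;> simp

/-- No two labels are opposite. -/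
def NC (l : List ℕ) : Prop := ∀ a ∈ l, ∀ b ∈ l, a / 2 = b / 2 → a = b

lemma al_ng (ε : Bool) (l : List ℕ) (h : NC l) : al ε (l.map ng) = al (!ε) l := by
  unfold al
  rw [srt_unique ((srt_perm l).map ng), g_ng]
  rw [List.pairwise_map]
  refine List.Pairwise.imp_of_mem ?_ (srt_pw l)
  intro a b ha hb hab
  have := h a ((srt_perm l).mem_iff.1 ha) b ((srt_perm l).mem_iff.1 hb)
  unfold ng
  by_cases h2 : a / 2 = b / 2
  · rw [this h2]
  · omega

lemma g_alt (s : List ℕ) : ∀ ε, g ε s ≠ 0 → s.Pairwise (· ≤ ·) → NC s →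
    s.Pairwise (fun a b => a / 2 < b / 2) := by
  induction s with
  | nil => intros; simp
  | cons a l ih =>
    intro ε hg hs hn
    simp only [g] at hg
    split_ifs at hg with h1
    · rw [List.pairwise_cons] at hs
      have hl := ih _ hg hs.2 (fun x hx y hy => hn x (by simp [hx]) y (by simp [hy]))
      rw [List.pairwise_cons]
      refine ⟨?_, hl⟩
      cases l with
      | nil => simp
      | cons b l =>
        have hab : a / 2 < b / 2 := by
          have h3 := hs.1 b (by simp)
          have h4 := hn a (by simp) b (by simp)
          by_contra h5
          have h6 := h4 (by omega)
          subst h6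
          simp only [g] at hg
          split_ifs at hg with h7
          · rw [h1] at h7; cases ε <;> simp at h7
          · simp at hg
        intro x hx
        rw [List.mem_cons] at hx
        rcases hx with rfl | hx
        · exact hab
        · rw [List.pairwise_cons] at hl
          exact hab.trans (hl.1 x hx)
    · simp at hg

lemma al_len (ε : Bool) (l : List ℕ) (h : al ε l ≠ 0) (hn : NC l) (M : ℕ)
    (hM : ∀ a ∈ l, a / 2 < M) : l.length ≤ M := by
  have hp := srt_perm l
  have h1 := g_alt (srt l) ε h (srt_pw l)
    (fun x hx y hy => hn x (hp.mem_iff.1 hx) y (hp.mem_iff.1 hy))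
  have h2 : ((srt l).map (· / 2)).Nodup := by
    unfold List.Nodup
    rw [List.pairwise_map]
    exact h1.imp (fun h => h.ne)
  have h3 : ((srt l).map (· / 2)).toFinset ⊆ Finset.range M := by
    intro x hx
    simp only [List.mem_toFinset, List.mem_map] at hx
    obtain ⟨y, hy, rfl⟩ := hx
    exact Finset.mem_range.2 (hM y (hp.mem_iff.1 hy))
  have h4 := Finset.card_le_card h3
  rw [List.toFinset_card_of_nodup h2, Finset.card_range, List.length_map, hp.length_eq] at h4
  exact h4

/-- Sum of `f` over all maximal flags below `X` (written as lists, from the top). -/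
def D {E : Type*} [DecidableEq E] : ℕ → Finset E → (List (Finset E) → ZMod 2) → ZMod 2
  | 0, _, f => f []
  | r + 1, X, f => ∑ e ∈ X, D r (X.erase e) (fun l => f (X :: l))

lemma D_add {E : Type*} [DecidableEq E] (r : ℕ) : ∀ (X : Finset E) (f f' : List (Finset E) → ZMod 2),
    D r X (fun x => f x + f' x) = D r X f + D r X f' := by
  induction r with
  | zero => intros; rfl
  | succ r ih => intro X f f'; simp only [D, ih, Finset.sum_add_distrib]

lemma sum_symm_zero {E : Type*} [DecidableEq E] (X : Finset E) (F : Finset E → ZMod 2) :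
    ∑ e ∈ X, ∑ e' ∈ X.erase e, F ((X.erase e).erase e') = 0 := by
  rw [Finset.sum_sigma']
  refine Finset.sum_involution (fun p _ => ⟨p.2, p.1⟩) ?_ ?_ ?_ ?_
  · rintro ⟨a, b⟩ _
    simp only
    rw [Finset.erase_right_comm, zz]
  · rintro ⟨a, b⟩ h _ h2
    simp at h h2
    exact h.2.1 h2.1
  · rintro ⟨a, b⟩ h
    simp at h ⊢
    exact ⟨h.2.2, fun h3 => h.2.1 h3.symm, h.1⟩
  · rintro ⟨a, b⟩ _; rfl

lemma D_bd {E : Type*} [DecidableEq E] (r : ℕ) : ∀ (X : Finset E) (f : List (Finset E) → ZMod 2),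
    D (r + 1) X (fun l => bd l f) = ∑ e ∈ X, D r (X.erase e) f := by
  induction r with
  | zero => intro X f; simp [D, bd]
  | succ r ih =>
    intro X f
    rw [D]
    simp only [bd, D_add, ih]
    rw [Finset.sum_add_distrib, sum_symm_zero X (fun Y => D r Y _), add_zero]

lemma D_congr {E : Type*} [DecidableEq E] (r : ℕ) :
    ∀ (X : Finset E) (f f' : List (Finset E) → ZMod 2), X.card = r →
    (∀ l, l.Pairwise (fun a b => b ⊆ a) → (∀ Y ∈ l, Y ⊆ X ∧ Y.Nonempty) → l.length = r →
      f l = f' l) → D r X f = D r X f' := by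
  induction r with
  | zero => intro X f f' _ h; exact h [] (by simp) (by simp) rfl
  | succ r ih =>
    intro X f f' hX h
    simp only [D]
    refine Finset.sum_congr rfl (fun e he => ih _ _ _ ?_ ?_)
    · rw [Finset.card_erase_of_mem he, hX]; rfl
    · intro l h1 h2 h3
      refine h _ ?_ ?_ (by simp [h3])
      · rw [List.pairwise_cons]
        exact ⟨fun Y hY => (h2 Y hY).1.trans (Finset.erase_subset _ _), h1⟩
      · intro Y hY
        rw [List.mem_cons] at hY
        rcases hY with rfl | hY
        · exact ⟨subset_rfl, ⟨e, he⟩⟩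
        · exact ⟨(h2 Y hY).1.trans (Finset.erase_subset _ _), (h2 Y hY).2⟩

lemma D_zero {E : Type*} [DecidableEq E] (r : ℕ) : ∀ (X : Finset E),
    D r X (fun _ => 0) = 0 := by
  induction r with
  | zero => intros; rfl
  | succ r ih => intro X; simp [D, ih]

/-- Antipode on literals. -/
def sw : ℕ × Bool ≃ ℕ × Bool := Equiv.prodCongr (Equiv.refl ℕ) Equiv.boolNot

/-- Antipode. -/
def neg (X : Finset (ℕ × Bool)) : Finset (ℕ × Bool) := X.map sw.toEmbedding

lemma D_neg (r : ℕ) : ∀ (X : Finset (ℕ × Bool)) f,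
    D r (neg X) f = D r X (fun l => f (l.map neg)) := by
  induction r with
  | zero => intros; rfl
  | succ r ih =>
    intro X f
    simp only [D]
    conv_lhs => rw [neg, Finset.sum_map]
    refine Finset.sum_congr rfl (fun e he => ?_)
    have : (neg X).erase (sw e) = neg (X.erase e) := by
      unfold neg; rw [Finset.map_erase]; rfl
    have h2 := ih (X.erase e) (fun l => f (neg X :: l))
    rw [← this] at h2
    exact h2

/-- Sum over all sign vectors on the first `k` coordinates. -/
def W : ℕ → (Finset (ℕ × Bool) → ZMod 2) → ZMod 2
  | 0, F => F ∅
  | k + 1, F => W k (fun X => F (insert (k, true) X) + F (insert (k, false) X))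

/-- Signed sets on the first `n` coordinates. -/
def Sg (n : ℕ) (X : Finset (ℕ × Bool)) : Prop :=
  (∀ e ∈ X, e.1 < n) ∧ ∀ i, ¬ ((i, true) ∈ X ∧ (i, false) ∈ X)

lemma Sg.mono {n : ℕ} {X Y : Finset (ℕ × Bool)} (h : Sg n X) (hY : Y ⊆ X) : Sg n Y :=
  ⟨fun e he => h.1 e (hY he), fun i hi => h.2 i ⟨hY hi.1, hY hi.2⟩⟩

lemma Sg.not_mem {n : ℕ} {X : Finset (ℕ × Bool)} (h : Sg n X) (b : Bool) : (n, b) ∉ X :=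
  fun h2 => lt_irrefl _ (h.1 _ h2)

lemma Sg.ins {n : ℕ} {X : Finset (ℕ × Bool)} (h : Sg n X) (b : Bool) :
    Sg (n + 1) (insert (n, b) X) := by
  constructor
  · intro e he
    rw [Finset.mem_insert] at he
    rcases he with rfl | he
    · simp
    · have := h.1 e he; omega
  · rintro i ⟨h1, h2⟩
    rw [Finset.mem_insert] at h1 h2
    rcases h1 with h1 | h1 <;> rcases h2 with h2 | h2
    · simp_all; 
    · simp at h1; rw [h1.1] at h2; exact h.not_mem _ h2
    · simp at h2; rw [h2.1] at h1; exact h.not_mem _ h1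
    · exact h.2 i ⟨h1, h2⟩

lemma W_congr (k : ℕ) : ∀ F F' : Finset (ℕ × Bool) → ZMod 2,
    (∀ X, Sg k X → X.card = k → F X = F' X) → W k F = W k F' := by
  induction k with
  | zero => intro F F' h; exact h ∅ (by simp [Sg]) rfl
  | succ k ih =>
    intro F F' h
    simp only [W]
    refine ih _ _ (fun X hX hc => ?_)
    rw [h _ (hX.ins true), h _ (hX.ins false)] <;>
      rw [Finset.card_insert_of_notMem (hX.not_mem _), hc]

lemma W_zero (k : ℕ) : W k (fun _ => 0) = 0 := by
  induction k with
  | zero => rfl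
  | succ r ih => simp [W, ih]

lemma W_add (k : ℕ) : ∀ F F' : Finset (ℕ × Bool) → ZMod 2,
    W k (fun X => F X + F' X) = W k F + W k F' := by
  induction k with
  | zero => intros; rfl
  | succ k ih =>
    intro F F'
    simp only [W, ih]; ring

lemma neg_insert (k : ℕ) (b : Bool) (X) : neg (insert (k, b) X) = insert (k, !b) (neg X) := by
  unfold neg; rw [Finset.map_insert]; rfl

lemma W_neg (k : ℕ) : ∀ F : Finset (ℕ × Bool) → ZMod 2,
    W k (fun X => F (neg X)) = W k F := by
  induction k with
  | zero => intros; rfl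
  | succ k ih =>
    intro F
    simp only [W, neg_insert]
    rw [← ih (fun X => F (insert (k, true) X) + F (insert (k, false) X))]
    congr 1; funext X; simp [add_comm]

lemma sum_ins (X : Finset (ℕ × Bool)) (p : ℕ × Bool) (hp : p ∉ X) (F : Finset (ℕ × Bool) → ZMod 2) :
    ∑ e ∈ insert p X, F ((insert p X).erase e) = F X + ∑ e ∈ X, F (insert p (X.erase e)) := by
  rw [Finset.sum_insert hp, Finset.erase_insert hp]
  congr 1
  refine Finset.sum_congr rfl (fun e he => ?_)
  rw [Finset.erase_insert_of_ne]
  rintro rfl; exact hp he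

lemma W_bd (k : ℕ) : ∀ F : Finset (ℕ × Bool) → ZMod 2,
    W k (fun X => ∑ e ∈ X, F (X.erase e)) = 0 := by
  induction k with
  | zero => intro F; simp [W]
  | succ k ih =>
    intro F
    rw [W, W_congr k _ (fun X => (∑ e ∈ X, F (insert (k, true) (X.erase e))) +
      ∑ e ∈ X, F (insert (k, false) (X.erase e))), W_add]
    · rw [ih (fun X => F (insert (k, true) X)), ih (fun X => F (insert (k, false) X)), add_zero]
    · intro X hX _
      rw [sum_ins X _ (hX.not_mem _), sum_ins X _ (hX.not_mem _)]
      have := zz (F X)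
      linear_combination this

/-- The value of `al ε` on the subdivided cell `X`. -/
def av (lam : Finset (ℕ × Bool) → ℕ) (ε : Bool) (X : Finset (ℕ × Bool)) : ZMod 2 := D X.card X (fun l => al ε (l.map lam))

lemma av_bd (lam : Finset (ℕ × Bool) → ℕ) (ε : Bool) (X : Finset (ℕ × Bool)) (hX : X.Nonempty) :
    ∑ e ∈ X, av lam ε (X.erase e) = av lam ε X + av lam (!ε) X := by
  obtain ⟨r, hr⟩ : ∃ r, X.card = r + 1 := ⟨X.card - 1, by have := hX.card_pos; omega⟩
  unfold av
  rw [← D_add, hr]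
  simp only [← al_bd, bd_map]
  rw [D_bd r X (fun l => al ε (l.map lam))]
  refine Finset.sum_congr rfl (fun e he => ?_)
  rw [Finset.card_erase_of_mem he, hr]; rfl

lemma chain_NC (n : ℕ) (lam : Finset (ℕ × Bool) → ℕ)
    (hcomp : ∀ X Y, Sg n Y → X.Nonempty → X ⊆ Y → lam X / 2 = lam Y / 2 → lam X = lam Y)
    (X : Finset (ℕ × Bool)) (hX : Sg n X) (l : List (Finset (ℕ × Bool)))
    (h1 : l.Pairwise (fun a b => b ⊆ a)) (h2 : ∀ Y ∈ l, Y ⊆ X ∧ Y.Nonempty) :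
    NC (l.map lam) := by
  intro a ha b hb hab
  rw [List.mem_map] at ha hb
  obtain ⟨A, hA, rfl⟩ := ha
  obtain ⟨B, hB, rfl⟩ := hb
  have : A ⊆ B ∨ B ⊆ A := by
    have h3 : l.Pairwise (fun a b => a ⊆ b ∨ b ⊆ a) := h1.imp (fun h => Or.inr h)
    have : Std.Symm (fun a b : Finset (ℕ × Bool) => a ⊆ b ∨ b ⊆ a) := ⟨fun _ _ h => h.symm⟩
    exact List.Pairwise.forall_of_forall (R := fun a b : Finset (ℕ × Bool) => a ⊆ b ∨ b ⊆ a)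
      (fun x _ => Or.inl (Finset.Subset.refl x)) h3 hA hB
  rcases this with h | h
  · exact hcomp A B (hX.mono (h2 B hB).1) (h2 A hA).2 h hab
  · exact (hcomp B A (hX.mono (h2 A hA).1) (h2 B hB).2 h hab.symm).symm

lemma av_neg (n : ℕ) (lam : Finset (ℕ × Bool) → ℕ)
    (hneg : ∀ X, Sg n X → X.Nonempty → lam (neg X) = ng (lam X))
    (hcomp : ∀ X Y, Sg n Y → X.Nonempty → X ⊆ Y → lam X / 2 = lam Y / 2 → lam X = lam Y)
    (ε : Bool) (X : Finset (ℕ × Bool)) (hX : Sg n X) :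
    av lam ε (neg X) = av lam (!ε) X := by
  unfold av
  rw [D_neg, show (neg X).card = X.card from Finset.card_map _]
  refine D_congr _ _ _ _ rfl (fun l h1 h2 _ => ?_)
  rw [← al_ng _ _ (chain_NC n lam hcomp X hX l h1 h2), List.map_map, List.map_map]
  congr 1
  refine List.map_congr_left (fun Y hY => ?_)
  exact hneg Y (hX.mono (h2 Y hY).1) (h2 Y hY).2

lemma Sg.le {n k : ℕ} {X : Finset (ℕ × Bool)} (h : Sg k X) (hk : k ≤ n) : Sg n X :=
  ⟨fun e he => (h.1 e he).trans_le hk, h.2⟩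

lemma hemi (n : ℕ) (lam : Finset (ℕ × Bool) → ℕ)
    (hneg : ∀ X, Sg n X → X.Nonempty → lam (neg X) = ng (lam X))
    (hcomp : ∀ X Y, Sg n Y → X.Nonempty → X ⊆ Y → lam X / 2 = lam Y / 2 → lam X = lam Y)
    (k : ℕ) : k < n →
    W k (fun X => av lam true (insert (k, true) X) + av lam false (insert (k, true) X)) = 1 := by
  induction k with
  | zero =>
    intro _
    have h := av_bd lam true {(0, true)} (by simp)
    simp only [Bool.not_true] at h
    simp only [W, insert_empty_eq]
    rw [← h]
    simp [av, D, al, srt, g]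
  | succ k ih =>
    intro hk
    rw [← ih (by omega)]
    rw [W_congr (k + 1) _ (fun X => av lam true X +
      ∑ e ∈ X, av lam true (insert (k + 1, true) (X.erase e))), W_add,
      W_bd (k + 1) (fun X => av lam true (insert (k + 1, true) X)), add_zero]
    · rw [W, W_add, W_add]
      congr 1
      rw [← W_neg]
      refine W_congr _ _ _ (fun X hX _ => ?_)
      have := av_neg n lam hneg hcomp true (insert (k, true) X) ((hX.ins true).le (by omega))
      rw [neg_insert] at this
      exact this
    · intro X hX _
      rw [← sum_ins X _ (hX.not_mem _), av_bd lam true _ (by simp)]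
      rfl

theorem tucker (n : ℕ) (lam : Finset (ℕ × Bool) → ℕ)
    (hneg : ∀ X, Sg n X → X.Nonempty → lam (neg X) = ng (lam X))
    (hcomp : ∀ X Y, Sg n Y → X.Nonempty → X ⊆ Y → lam X / 2 = lam Y / 2 → lam X = lam Y)
    (hn : 1 ≤ n) (hM : ∀ X, Sg n X → X.Nonempty → lam X / 2 < n - 1) : False := by
  obtain ⟨k, rfl⟩ : ∃ k, n = k + 1 := ⟨n - 1, by omega⟩
  have h := hemi (k + 1) lam hneg hcomp k (by omega)
  rw [W_congr _ _ (fun _ => 0), W_zero] at h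
  · simp at h
  · intro X hX hc
    have key : ∀ ε, av lam ε (insert (k, true) X) = 0 := by
      intro ε
      have hY := hX.ins true
      unfold av
      rw [D_congr _ _ _ (fun _ => 0) rfl, D_zero]
      intro l h1 h2 h3
      by_contra h4
      have := al_len ε _ h4 (chain_NC (k + 1) lam hcomp _ hY l h1 h2) k (by
        intro a ha
        rw [List.mem_map] at ha
        obtain ⟨A, hA, rfl⟩ := ha
        exact hM A (hY.mono (h2 A hA).1) (h2 A hA).2)
      rw [List.length_map, h3, Finset.card_insert_of_notMem (hX.not_mem _), hc] at this
      omega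
    rw [key, key, add_zero]


/-- Signs alternate, starting with `ε`. -/
def IsA : Bool → List (ℕ × Bool) → Prop
  | _, [] => True
  | ε, a :: l => a.2 = ε ∧ IsA (!ε) l

/-- `X` has an alternating subsequence of length `r` starting with `ε`. -/
def HasAlt (ε : Bool) (X : Finset (ℕ × Bool)) (r : ℕ) : Prop :=
  ∃ L : List (ℕ × Bool), L.length = r ∧ L.Pairwise (fun a b => a.1 < b.1) ∧ IsA ε L ∧ ∀ e ∈ L, e ∈ X

open Classical in
/-- Length of the longest alternating subsequence starting with `ε`. -/
noncomputable def altL (ε : Bool) (X : Finset (ℕ × Bool)) : ℕ :=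
  Nat.findGreatest (HasAlt ε X) X.card

lemma le_altL {ε : Bool} {X : Finset (ℕ × Bool)} {r : ℕ} (h : HasAlt ε X r) : r ≤ altL ε X := by
  classical
  refine Nat.le_findGreatest ?_ h
  obtain ⟨L, rfl, h1, -, h2⟩ := h
  have hn : L.Nodup := h1.imp (fun h3 h4 => by rw [h4] at h3; exact lt_irrefl _ h3)
  rw [← List.toFinset_card_of_nodup hn]
  exact Finset.card_le_card (fun e he => h2 e (by simpa using he))

lemma altL_spec (ε : Bool) (X : Finset (ℕ × Bool)) : HasAlt ε X (altL ε X) := by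
  classical
  exact Nat.findGreatest_spec (P := HasAlt ε X) (m := 0) (Nat.zero_le _)
    ⟨[], rfl, List.Pairwise.nil, trivial, by simp⟩

lemma altL_mono (ε : Bool) {X Y : Finset (ℕ × Bool)} (h : X ⊆ Y) : altL ε X ≤ altL ε Y := by
  obtain ⟨L, h1, h2, h3, h4⟩ := altL_spec ε X
  exact le_altL ⟨L, h1, h2, h3, fun e he => h (h4 e he)⟩

lemma mem_neg (X : Finset (ℕ × Bool)) (i : ℕ) (b : Bool) : (i, b) ∈ neg X ↔ (i, !b) ∈ X := by
  unfold neg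
  simp [sw]

lemma neg_neg' (X : Finset (ℕ × Bool)) : neg (neg X) = X := by
  ext ⟨i, b⟩; simp [mem_neg]

lemma IsA_map (L : List (ℕ × Bool)) : ∀ ε, IsA ε L → IsA (!ε) (L.map (fun e => (e.1, !e.2))) := by
  induction L with
  | nil => intros; trivial
  | cons a l ih =>
    intro ε h
    refine ⟨congrArg not h.1, ih _ h.2⟩

lemma altL_neg_le (ε : Bool) (X : Finset (ℕ × Bool)) : altL ε (neg X) ≤ altL (!ε) X := by
  obtain ⟨L, h1, h2, h3, h4⟩ := altL_spec ε (neg X)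
  refine le_altL ⟨L.map (fun e => (e.1, !e.2)), by simpa using h1, ?_, IsA_map L ε h3, ?_⟩
  · rw [List.pairwise_map]; exact h2
  · intro e he
    rw [List.mem_map] at he
    obtain ⟨⟨i, b⟩, hx, rfl⟩ := he
    exact (mem_neg X i b).1 (h4 _ hx)

lemma altL_neg (ε : Bool) (X : Finset (ℕ × Bool)) : altL ε (neg X) = altL (!ε) X := by
  refine le_antisymm (altL_neg_le ε X) ?_
  have := altL_neg_le (!ε) (neg X)
  rwa [neg_neg', Bool.not_not] at this

lemma altL_ne {n : ℕ} {X : Finset (ℕ × Bool)} (hX : Sg n X) (hne : X.Nonempty) :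
    altL true X ≠ altL false X := by
  obtain ⟨⟨i, ε⟩, he, hmin⟩ := Finset.exists_min_image X Prod.fst hne
  have key : altL (!ε) X + 1 ≤ altL ε X := by
    obtain ⟨L, h1, h2, h3, h4⟩ := altL_spec (!ε) X
    refine le_altL ⟨(i, ε) :: L, by simp [h1], ?_, ⟨rfl, h3⟩, ?_⟩
    · rw [List.pairwise_cons]
      refine ⟨?_, h2⟩
      cases L with
      | nil => simp
      | cons b l =>
        have hb := h4 b (by simp)
        have h5 := hmin b hb
        have h6 : b.1 ≠ i := by
          intro h7
          obtain ⟨j, β⟩ := b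
          have h8 : β = !ε := h3.1
          subst h8
          simp only at h7
          subst h7
          apply hX.2 j
          cases ε
          · exact ⟨hb, he⟩
          · exact ⟨he, hb⟩
        have h9 : i < b.1 := lt_of_le_of_ne h5 (Ne.symm h6)
        intro x hx
        rw [List.mem_cons] at hx
        rcases hx with rfl | hx
        · exact h9
        · rw [List.pairwise_cons] at h2
          exact h9.trans (h2.1 x hx)
    · intro e h
      rw [List.mem_cons] at h
      rcases h with rfl | h
      · exact he
      · exact h4 e h
  cases ε <;> simp at key <;> omega

lemma IsA_count (L : List (ℕ × Bool)) (δ : Bool) : ∀ ε, IsA ε L →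
    L.length ≤ 2 * (L.filter (fun e => e.2 = δ)).length + (if ε = δ then 0 else 1) := by
  induction L with
  | nil => intros; simp
  | cons a l ih =>
    intro ε h
    have := ih _ h.2
    have h1 := h.1
    cases hε : ε <;> cases hδ : δ <;> subst hε <;> subst hδ <;> simp [h1] at this ⊢ <;> omega

lemma IsA_stable (L : List (ℕ × Bool)) (δ : Bool) : ∀ ε, IsA ε L →
    L.Pairwise (fun a b => a.1 < b.1) → ∀ i, (i, δ) ∈ L → (i + 1, δ) ∈ L → False := by
  induction L with
  | nil => intro ε _ _ i h; simp at h
  | cons a l ih =>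
    intro ε h hp i h1 h2
    rw [List.pairwise_cons] at hp
    rw [List.mem_cons] at h1 h2
    rcases h1 with h1 | h1 <;> rcases h2 with h2 | h2
    · rw [← h1] at h2; simp at h2
    · cases l with
      | nil => simp at h2
      | cons b l =>
        have h3 := hp.1 b (by simp)
        have h4 : b.2 = !ε := h.2.1
        have h5 : a.2 = ε := h.1
        rw [← h1] at h3 h5
        simp only at h3 h5
        rw [List.mem_cons] at h2
        rcases h2 with h2 | h2
        · rw [← h2] at h4; simp only at h4; rw [h5] at h4; cases ε <;> simp at h4
        · have h6 := (List.pairwise_cons.1 hp.2).1 _ h2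
          simp only at h6; omega
    · have := hp.1 _ h1
      rw [← h2] at this; simp only at this; omega
    · exact ih _ h.2 hp.2 i h1 h2

lemma stable_of_alt (δ ε : Bool) (X : Finset (ℕ × Bool)) (T : ℕ) (h : 2 * T ≤ altL ε X) :
    ∃ U : Finset ℕ, U.card = T ∧ (∀ j ∈ U, (j, δ) ∈ X) ∧ ∀ j ∈ U, j + 1 ∉ U := by
  obtain ⟨L, h1, h2, h3, h4⟩ := altL_spec ε X
  have hc := IsA_count L δ ε h3
  set V : List ℕ := (L.filter (fun e => e.2 = δ)).map Prod.fst with hV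
  have hmem : ∀ j, j ∈ V → (j, δ) ∈ L := by
    intro j hj
    rw [hV, List.mem_map] at hj
    obtain ⟨⟨a, b⟩, hx, rfl⟩ := hj
    simp only [List.mem_filter, decide_eq_true_eq] at hx
    rw [← hx.2]; exact hx.1
  have hn : V.Nodup := by
    unfold List.Nodup
    rw [hV, List.pairwise_map]
    exact (h2.sublist List.filter_sublist).imp (fun h => h.ne)
  have hlen : T ≤ V.toFinset.card := by
    rw [List.toFinset_card_of_nodup hn, hV, List.length_map]
    split_ifs at hc <;> omega
  obtain ⟨U, hU, hUc⟩ := Finset.exists_subset_card_eq hlen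
  have hU2 : ∀ j ∈ U, (j, δ) ∈ L := fun j hj => hmem j (by simpa using hU hj)
  exact ⟨U, hUc, fun j hj => h4 _ (hU2 j hj),
    fun j hj hj2 => IsA_stable L δ ε h3 h2 j (hU2 j hj) (hU2 _ hj2)⟩

/-- Number of vertices of colour `i` with sign `δ`. -/
def cnt (N : ℕ) (c : ℕ → ℕ) (δ : Bool) (i : ℕ) (X : Finset (ℕ × Bool)) : ℕ :=
  ((Finset.range N).filter (fun j => c j = i ∧ (j, δ) ∈ X)).card

lemma cnt_neg (N : ℕ) (c : ℕ → ℕ) (δ : Bool) (i : ℕ) (X : Finset (ℕ × Bool)) :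
    cnt N c δ i (neg X) = cnt N c (!δ) i X := by
  unfold cnt; simp only [mem_neg]

lemma cnt_mono (N : ℕ) (c : ℕ → ℕ) (δ : Bool) (i : ℕ) {X Y : Finset (ℕ × Bool)} (h : X ⊆ Y) :
    cnt N c δ i X ≤ cnt N c δ i Y := by
  refine Finset.card_le_card (fun j hj => ?_)
  rw [Finset.mem_filter] at hj ⊢
  exact ⟨hj.1, hj.2.1, h hj.2.2⟩

lemma cnt_add (N : ℕ) (c : ℕ → ℕ) (i : ℕ) {X : Finset (ℕ × Bool)} (h : Sg N X) :
    cnt N c true i X + cnt N c false i X ≤ ((Finset.range N).filter (fun j => c j = i)).card := by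
  unfold cnt
  rw [← Finset.card_union_of_disjoint]
  · refine Finset.card_le_card (fun j hj => ?_)
    simp only [Finset.mem_union, Finset.mem_filter] at hj ⊢
    tauto
  · rw [Finset.disjoint_left]
    intro j h1 h2
    rw [Finset.mem_filter] at h1 h2
    exact h.2 j ⟨h1.2.2, h2.2.2⟩

/-- Colours with a strict majority in `X`. -/
def maj (N m : ℕ) (c t : ℕ → ℕ) (X : Finset (ℕ × Bool)) : Set ℕ :=
  {i | i < m ∧ (t i < cnt N c true i X ∨ t i < cnt N c false i X)}

/-- The labelling for Tucker's lemma. -/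
noncomputable def lb (N m T : ℕ) (c t : ℕ → ℕ) (X : Finset (ℕ × Bool)) : ℕ :=
  if max (altL true X) (altL false X) < 2 * T then
    2 * (max (altL true X) (altL false X) - 1) + (if altL false X < altL true X then 1 else 0)
  else 2 * (2 * T - 1 + sInf (maj N m c t X)) +
    (if t (sInf (maj N m c t X)) < cnt N c true (sInf (maj N m c t X)) X then 1 else 0)

theorem core (N m : ℕ) (c t : ℕ → ℕ) (hc : ∀ j < N, c j < m)
    (ht : ∀ i < m, ((Finset.range N).filter (fun j => c j = i)).card = 2 * t i + 1) :
    ∃ S ⊆ Finset.range N, (∀ j ∈ S, j + 1 ∉ S) ∧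
      ∀ i < m, t i ≤ (S.filter (fun j => c j = i)).card := by
  by_contra hcon
  set T := ∑ i ∈ Finset.range m, t i with hT
  have hN : N = 2 * T + m := by
    have h := Finset.card_eq_sum_card_fiberwise (f := c) (s := Finset.range N)
      (t := Finset.range m) (fun j hj => by simpa using hc j (by simpa using hj))
    rw [Finset.card_range] at h
    rw [h, Finset.sum_congr rfl (fun i hi => ht i (Finset.mem_range.1 hi)),
      Finset.sum_add_distrib, ← Finset.mul_sum]
    simp [hT]
  have hTpos : 1 ≤ T := by
    by_contra h0
    have h0 : T = 0 := by omega
    rw [hT, Finset.sum_eq_zero_iff] at h0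
    exact hcon ⟨∅, by simp, by simp, fun i hi => by simp [h0 i (Finset.mem_range.2 hi)]⟩
  have hmaj : ∀ X, Sg N X → ¬ max (altL true X) (altL false X) < 2 * T →
      (maj N m c t X).Nonempty := by
    intro X hX h
    have : ∃ ε, 2 * T ≤ altL ε X := by
      rcases le_max_iff.1 (not_lt.1 h) with h | h
      · exact ⟨_, h⟩
      · exact ⟨_, h⟩
    obtain ⟨ε, hε⟩ := this
    obtain ⟨U, hU1, hU2, hU3⟩ := stable_of_alt true ε X T hε
    have hUr : U ⊆ Finset.range N := fun j hj => Finset.mem_range.2 (hX.1 _ (hU2 j hj))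
    by_contra hno
    rw [Set.not_nonempty_iff_eq_empty, Set.eq_empty_iff_forall_notMem] at hno
    have hle : ∀ i ∈ Finset.range m, (U.filter (fun j => c j = i)).card ≤ t i := by
      intro i hi
      by_contra h5
      refine hno i ⟨Finset.mem_range.1 hi, Or.inl ((not_le.1 h5).trans_le ?_)⟩
      refine Finset.card_le_card (fun j hj => ?_)
      rw [Finset.mem_filter] at hj ⊢
      exact ⟨hUr hj.1, hj.2, hU2 j hj.1⟩
    have hsum : ∑ i ∈ Finset.range m, (U.filter (fun j => c j = i)).card
        = ∑ i ∈ Finset.range m, t i := by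
      rw [← hT, ← hU1]
      exact (Finset.card_eq_sum_card_fiberwise (f := c) (s := U) (t := Finset.range m)
        (fun j hj => by simpa using hc j (by simpa using hUr hj))).symm
    rw [Finset.sum_eq_sum_iff_of_le hle] at hsum
    exact hcon ⟨U, hUr, hU3, fun i hi => (hsum i (Finset.mem_range.2 hi)).ge⟩
  have hpos : ∀ X, Sg N X → X.Nonempty → 1 ≤ max (altL true X) (altL false X) := by
    intro X hX hne
    have := altL_ne hX hne
    omega
  have hexcl : ∀ X, Sg N X → ∀ i < m, cnt N c true i X + cnt N c false i X ≤ 2 * t i + 1 :=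
    fun X hX i hi => (cnt_add N c i hX).trans (ht i hi).le
  refine tucker N (lb N m T c t) ?_ ?_ (by omega) ?_
  · intro X hX hne
    have hm : maj N m c t (neg X) = maj N m c t X := by
      ext i; simp only [maj, cnt_neg, Set.mem_ofPred_eq, Bool.not_true, Bool.not_false]; tauto
    unfold lb ng
    rw [hm]
    simp only [altL_neg, cnt_neg, Bool.not_true, Bool.not_false]
    rw [max_comm (altL false X)]
    have h1 := altL_ne hX hne
    by_cases h : max (altL true X) (altL false X) < 2 * T
    · simp only [h, if_true]
      split_ifs <;> omega
    · have h2 := Nat.sInf_mem (hmaj X hX h)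
      have h3 := hexcl X hX _ h2.1
      have h4 := h2.2
      simp only [h, if_false]
      split_ifs <;> omega
  · intro X Y hY hne hXY heq
    have hX := hY.mono hXY
    have a1 := altL_ne hX hne
    have a2 := altL_ne hY (hne.mono hXY)
    have a3 := altL_mono true hXY
    have a4 := altL_mono false hXY
    have p1 := hpos X hX hne
    have p2 := hpos Y hY (hne.mono hXY)
    unfold lb at heq ⊢
    by_cases hx : max (altL true X) (altL false X) < 2 * T
    · by_cases hy : max (altL true Y) (altL false Y) < 2 * T
      · simp only [hx, hy, if_true] at heq ⊢
        split_ifs at heq ⊢ <;> omega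
      · simp only [hx, hy, if_true, if_false] at heq ⊢
        split_ifs at heq ⊢ <;> omega
    · by_cases hy : max (altL true Y) (altL false Y) < 2 * T
      · simp only [hx, hy, if_true, if_false] at heq ⊢
        split_ifs at heq ⊢ <;> omega
      · simp only [hx, hy, if_false] at heq ⊢
        have hs : sInf (maj N m c t X) = sInf (maj N m c t Y) := by
          split_ifs at heq <;> omega
        have h2 := Nat.sInf_mem (hmaj X hX hx)
        have h3 := Nat.sInf_mem (hmaj Y hY hy)
        rw [← hs] at h3 ⊢
        have h4 := hexcl Y hY _ h3.1
        have h5 := h2.2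
        have h6 := h3.2
        have h7 := cnt_mono N c true (sInf (maj N m c t X)) hXY
        have h8 := cnt_mono N c false (sInf (maj N m c t X)) hXY
        split_ifs <;> omega
  · intro X hX hne
    have p1 := hpos X hX hne
    unfold lb
    by_cases hx : max (altL true X) (altL false X) < 2 * T
    · simp only [hx, if_true]
      split_ifs <;> omega
    · have h2 := (Nat.sInf_mem (hmaj X hX hx)).1
      simp only [hx, if_false]
      split_ifs <;> omega

end FairPath

/-- Almost-½-fair representation in paths: for every partition of the vertex set of the
path `Pₙ` there is an independent set meeting each part `A i` in at least `|A i|/2 - 1`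
elements. -/
theorem stmt16 (n : ℕ) (m : ℕ) (A : Fin m → Finset (Fin n))
    (hdisj : ∀ i j, i ≠ j → Disjoint (A i) (A j))
    (hcover : Finset.univ.biUnion A = Finset.univ) :
    ∃ S : Finset (Fin n),
      (∀ v ∈ S, ∀ w ∈ S, ¬ (SimpleGraph.pathGraph n).Adj v w) ∧
      ∀ i : Fin m, ((A i).card : ℝ) / 2 - 1 ≤ ((S ∩ A i).card : ℝ) := by
  classical
  have hex : ∀ v : Fin n, ∃ i, v ∈ A i := by
    intro v
    have : v ∈ Finset.univ.biUnion A := by rw [hcover]; exact Finset.mem_univ v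
    simpa using this
  choose c0 hc0 using hex
  have hA : ∀ i v, v ∈ A i ↔ c0 v = i := by
    intro i v
    constructor
    · intro h
      by_contra hne
      exact Finset.disjoint_left.1 (hdisj _ _ hne) (hc0 v) h
    · rintro rfl; exact hc0 v
  set E : Finset (Fin m) := Finset.univ.filter (fun i => Even (A i).card) with hE
  let φ := E.orderIsoOfFin rfl
  let c : ℕ → ℕ := fun j => if h : j < n then (c0 ⟨j, h⟩ : ℕ) else
    if h : j - n < E.card then ((φ ⟨j - n, h⟩ : Fin m) : ℕ) else 0
  let t : ℕ → ℕ := fun i => if h : i < m then (A ⟨i, h⟩).card / 2 else 0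
  have hc1 : ∀ v : Fin n, c v = c0 v := by
    intro v; simp [c]
  have hc2 : ∀ x : Fin E.card, c (n + x) = (φ x : Fin m) := by
    intro x; simp [c]
  have hG : ∀ i : Fin m, ((Finset.range (n + E.card)).filter (fun j => n ≤ j ∧ c j = i)).card =
      if Even (A i).card then 1 else 0 := by
    intro i
    by_cases hi : i ∈ E
    · have hi2 : Even (A i).card := by simpa [hE] using hi
      rw [if_pos hi2, Finset.card_eq_one]
      refine ⟨n + (φ.symm ⟨i, hi⟩ : Fin E.card), ?_⟩
      ext j
      simp only [Finset.mem_filter, Finset.mem_range, Finset.mem_singleton]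
      constructor
      · rintro ⟨h1, h2, h3⟩
        obtain ⟨x, rfl⟩ : ∃ x : Fin E.card, j = n + x := ⟨⟨j - n, by omega⟩, by simp; omega⟩
        rw [hc2] at h3
        have : φ x = ⟨i, hi⟩ := Subtype.ext (Fin.ext h3)
        rw [← this]; simp
      · rintro rfl
        refine ⟨by omega, by omega, ?_⟩
        rw [hc2]; simp
    · have hi2 : ¬ Even (A i).card := by simpa [hE] using hi
      rw [if_neg hi2, Finset.card_eq_zero, Finset.filter_eq_empty_iff]
      rintro j hj ⟨h2, h3⟩
      rw [Finset.mem_range] at hj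
      obtain ⟨x, rfl⟩ : ∃ x : Fin E.card, j = n + x := ⟨⟨j - n, by omega⟩, by simp; omega⟩
      rw [hc2] at h3
      apply hi
      rw [← Fin.ext h3]
      exact (φ x).2
  have hsplit : ∀ (S : Finset ℕ) (i : Fin m), S ⊆ Finset.range (n + E.card) →
      S.filter (fun j => c j = i) = ((Finset.univ.filter (fun v : Fin n => (v : ℕ) ∈ S)) ∩ A i).map
        Fin.valEmbedding ∪ S.filter (fun j => n ≤ j ∧ c j = i) := by
    intro S i _
    ext j
    simp only [Finset.mem_filter, Finset.mem_union, Finset.mem_map, Finset.mem_inter,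
      Finset.mem_univ, true_and, Fin.valEmbedding_apply]
    constructor
    · rintro ⟨h1, h2⟩
      by_cases hj : j < n
      · left
        refine ⟨⟨j, hj⟩, ⟨h1, ?_⟩, rfl⟩
        rw [hA]
        apply Fin.ext
        rw [← h2, ← hc1]
      · right; exact ⟨h1, by omega, h2⟩
    · rintro (⟨v, ⟨h1, h2⟩, rfl⟩ | ⟨h1, h2, h3⟩)
      · refine ⟨h1, ?_⟩
        rw [hc1, (hA i v).1 h2]
      · exact ⟨h1, h3⟩
  obtain ⟨S, hS1, hS2, hS3⟩ := FairPath.core (n + E.card) m c t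
    (by
      intro j hj
      by_cases h : j < n
      · simp [c, h]
      · have : j - n < E.card := by omega
        simp [c, h, this])
    (by
      intro i hi
      have h := hsplit (Finset.range (n + E.card)) ⟨i, hi⟩ subset_rfl
      simp only at h
      have hG' := hG ⟨i, hi⟩
      rw [h, Finset.card_union_of_disjoint, hG', Finset.card_map]
      · have : (Finset.univ.filter (fun v : Fin n => (v : ℕ) ∈ Finset.range (n + E.card)))
            = Finset.univ := by
          ext v; simp; omega
        rw [this, Finset.univ_inter]
        simp only [t, hi, dif_pos]
        split_ifs with h2
        · have := Nat.even_iff.1 h2; omega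
        · have := Nat.not_even_iff.1 h2; omega
      · rw [Finset.disjoint_left]
        intro j h1 h2
        simp only [Finset.mem_map, Fin.valEmbedding_apply] at h1
        obtain ⟨v, -, rfl⟩ := h1
        simp only [Finset.mem_filter] at h2
        omega)
  refine ⟨Finset.univ.filter (fun v : Fin n => (v : ℕ) ∈ S), ?_, ?_⟩
  · intro v hv w hw hadj
    simp only [Finset.mem_filter, Finset.mem_univ, true_and] at hv hw
    rw [SimpleGraph.pathGraph_adj] at hadj
    rcases hadj with h | h
    · exact hS2 _ hv (by rw [h]; exact hw)
    · exact hS2 _ hw (by rw [h]; exact hv)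
  · intro i
    have h1 := hS3 i i.2
    rw [hsplit S i hS1] at h1
    have h2 := h1.trans (Finset.card_union_le _ _)
    rw [Finset.card_map] at h2
    have h3 : (S.filter (fun j => n ≤ j ∧ c j = i)).card ≤ if Even (A i).card then 1 else 0 := by
      rw [← hG i]
      exact Finset.card_le_card (Finset.filter_subset_filter _ hS1)
    have h4 : t i = (A i).card / 2 := by simp [t]
    have h5 : (A i).card ≤
        2 * ((Finset.univ.filter (fun v : Fin n => (v : ℕ) ∈ S)) ∩ A i).card + 2 := by
      split_ifs at h3 with h7
      · have := Nat.even_iff.1 h7; omega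
      · have := Nat.not_even_iff.1 h7; omega
    have h6 : ((A i).card : ℝ) ≤
        2 * (((Finset.univ.filter (fun v : Fin n => (v : ℕ) ∈ S)) ∩ A i).card : ℝ) + 2 := by
      exact_mod_cast h5
    linarith
end
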